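/- arXiv:1710.07901 — 5 statements merged into one kernel-verified Lean document; each statement's English description precedes it below -/
import Mathlib

section
/- Let X be a separable infinite-dimensional complex Banach space and let T be a bounded linear operator on X. Suppose there exists a vector x₀ ∈ X which is bicyclic for T with associated family (xₙ)_{n∈ℤ}, such that (b) the series Σ_{n∈ℤ} x_{−n} (i.e. Σ_{n∈ℤ} T^{−n}x₀) is unconditionally convergent, and (c) there exists a non-zero continuous linear functional x₀* ∈ X* and a finite set F ⊆ ℤ such that ⟨x₀*, xₙ⟩ = 0 for every n ∈ ℤ∖F. Then T admits a frequently hypercyclic vector x with an irregularly visiting orbit; more precisely, setting U₀ = {y ∈ X : Re⟨x₀*, y⟩ > 0}, the set N(x,U₀) = {n ≥ 1 : Tⁿx ∈ U₀} satisfies lower-dens N(x,U₀) < upper-dens N(x,U₀). -/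
open Filter Topology

/-- The proportion of elements of `A` in `[1, n]`. -/
noncomputable def partialDensity (A : Set ℕ) (n : ℕ) : ℝ :=
  ((A ∩ Set.Icc 1 n).ncard : ℝ) / n

/-- Lower density of a set of natural numbers. -/
noncomputable def lowerDensity (A : Set ℕ) : ℝ :=
  Filter.liminf (fun N : ℕ => partialDensity A N) Filter.atTop

/-- Upper density of a set of natural numbers. -/
noncomputable def upperDensity (A : Set ℕ) : ℝ :=
  Filter.limsup (fun N : ℕ => partialDensity A N) Filter.atTop

theorem partialDensity_nonneg (A : Set ℕ) (n : ℕ) : 0 ≤ partialDensity A n := by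
  unfold partialDensity; positivity

theorem partialDensity_le_one (A : Set ℕ) (n : ℕ) : partialDensity A n ≤ 1 := by
  unfold partialDensity
  refine div_le_one_of_le₀ ?_ n.cast_nonneg
  have h := Set.ncard_le_ncard (Set.inter_subset_right : A ∩ Set.Icc 1 n ⊆ _) (Set.finite_Icc 1 n)
  have h2 : (Set.Icc 1 n).ncard = n := by
    rw [← Finset.coe_Icc, Set.ncard_coe_finset]; simp
  exact_mod_cast h2 ▸ h

theorem le_lowerDensity {A : Set ℕ} {c : ℝ} (h : ∀ᶠ N in atTop, c ≤ partialDensity A N) :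
    c ≤ lowerDensity A :=
  le_liminf_of_le
    (isCoboundedUnder_ge_of_le atTop (x := 1) fun n => partialDensity_le_one A n) h

theorem lowerDensity_le {A : Set ℕ} {c : ℝ} (h : ∃ᶠ N in atTop, partialDensity A N ≤ c) :
    lowerDensity A ≤ c :=
  liminf_le_of_frequently_le h
    (isBoundedUnder_of_eventually_ge (a := 0) (.of_forall fun n => partialDensity_nonneg A n))

theorem le_upperDensity {A : Set ℕ} {c : ℝ} (h : ∃ᶠ N in atTop, c ≤ partialDensity A N) :
    c ≤ upperDensity A :=
  le_limsup_of_frequently_le h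
    (isBoundedUnder_of_eventually_le (a := 1) (.of_forall fun n => partialDensity_le_one A n))

theorem ncard_inter_Icc_mono {A B : Set ℕ} {n : ℕ} (h : A ∩ Set.Icc 1 n ⊆ B) :
    (A ∩ Set.Icc 1 n).ncard ≤ (B ∩ Set.Icc 1 n).ncard :=
  Set.ncard_le_ncard (Set.subset_inter h Set.inter_subset_right)
    ((Set.finite_Icc 1 n).subset Set.inter_subset_right)

theorem ncard_union_inter_Icc_le (A B : Set ℕ) (n : ℕ) :
    ((A ∪ B) ∩ Set.Icc 1 n).ncard ≤ (A ∩ Set.Icc 1 n).ncard + (B ∩ Set.Icc 1 n).ncard := by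
  rw [Set.union_inter_distrib_right]
  exact Set.ncard_union_le _ _

theorem ncard_Iic_inter_Icc_le (a n : ℕ) : (Set.Iic a ∩ Set.Icc 1 n).ncard ≤ a := by
  have h : (Set.Iic a ∩ Set.Icc 1 n) ⊆ (Finset.Icc 1 a : Finset ℕ) := by
    rintro m ⟨h1, h2, -⟩
    simpa using ⟨h2, h1⟩
  have := Set.ncard_le_ncard h
  rw [Set.ncard_coe_finset] at this
  simpa using this

theorem ncard_multiples (q n : ℕ) : ({m | q ∣ m} ∩ Set.Icc 1 n).ncard = n / q := by
  rw [← Nat.Ioc_filter_dvd_card_eq_div, ← Set.ncard_coe_finset]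
  congr 1
  ext m
  simp [Nat.succ_le_iff, and_comm]

theorem lowerDensity_pos {A S : Set ℕ} {q n₀ : ℕ} (hq : 0 < q)
    (hA : ∀ N, 3 * N ≤ 4 * q * ((A ∩ Set.Icc 1 N).ncard + 1))
    (hS : ∀ n ∈ A, n₀ ≤ n → n ∈ S) : 0 < lowerDensity S := by
  have hq' : (0 : ℝ) < q := by exact_mod_cast hq
  refine lt_of_lt_of_le (by positivity : (0 : ℝ) < 1 / (4 * q)) (le_lowerDensity ?_)
  filter_upwards [eventually_ge_atTop (2 * q * (n₀ + 1)), eventually_ge_atTop 1] with N hN hN1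
  have h1 : (A ∩ Set.Icc 1 N).ncard ≤ (S ∩ Set.Icc 1 N).ncard + n₀ := by
    refine (ncard_inter_Icc_mono (B := S ∪ Set.Iic n₀) ?_).trans
      ((ncard_union_inter_Icc_le _ _ _).trans
        (Nat.add_le_add_left (ncard_Iic_inter_Icc_le _ _) _))
    rintro n ⟨hn, -⟩
    rcases le_total n₀ n with h | h
    · exact Or.inl (hS n hn h)
    · exact Or.inr h
  have h2 := hA N
  have h3 : N ≤ 4 * q * (S ∩ Set.Icc 1 N).ncard := by nlinarith
  unfold partialDensity
  have hN' : (0 : ℝ) < N := by exact_mod_cast hN1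
  rw [div_le_div_iff₀ (by positivity) hN']
  have h4 : (N : ℝ) ≤ 4 * q * (S ∩ Set.Icc 1 N).ncard := by exact_mod_cast h3
  linarith

/-- The natural numbers at distance at most `r` from a positive multiple of `q`. -/
def nearMultiples (q r : ℕ) : Set ℕ :=
  {n | ∃ m, 1 ≤ m ∧ q ∣ m ∧ n ≤ m + r ∧ m ≤ n + r}

theorem ncard_nearMultiples_le {q r : ℕ} (hq : 2 * r < q) (N : ℕ) :
    (nearMultiples q r ∩ Set.Icc 1 N).ncard * q ≤ 2 * N * (2 * r + 1) := by
  have h1 : nearMultiples q r ∩ Set.Icc 1 N ⊆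
      ((Finset.Icc 1 ((N + r) / q) ×ˢ Finset.range (2 * r + 1)).image
        fun x => x.1 * q + x.2 - r : Finset ℕ) := by
    rintro n ⟨⟨m, hm, ⟨k, rfl⟩, h1, h2⟩, h3, h4⟩
    simp only [Finset.coe_image, Set.mem_image, Finset.mem_coe, Finset.mem_product,
      Finset.mem_Icc, Finset.mem_range, Prod.exists]
    refine ⟨k, n + r - q * k, ⟨⟨?_, ?_⟩, by omega⟩, ?_⟩
    · rcases Nat.eq_zero_or_pos k with rfl | h
      · simp at hm
      · exact h
    · rw [Nat.le_div_iff_mul_le (by omega), mul_comm]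
      omega
    · rw [mul_comm k q]; omega
  have h2 := Set.ncard_le_ncard h1
  rw [Set.ncard_coe_finset] at h2
  have h3 := h2.trans Finset.card_image_le
  simp only [Finset.card_product, Nat.card_Icc, Finset.card_range, Nat.add_sub_cancel] at h3
  have h4 : (N + r) / q * q ≤ 2 * N := by
    rcases Nat.lt_or_ge (N + r) q with h | h
    · simp [Nat.div_eq_of_lt h]
    · have := Nat.div_mul_le_self (N + r) q
      omega
  calc _ ≤ (N + r) / q * (2 * r + 1) * q := Nat.mul_le_mul_right _ h3
    _ = (N + r) / q * q * (2 * r + 1) := by ring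
    _ ≤ _ := Nat.mul_le_mul_right _ h4

/-- A rapidly increasing sequence of periods, adapted to the radii `R`. -/
def period (R : ℕ → ℕ) (p : ℕ) : ℕ → ℕ
  | 0 => p
  | l + 1 => 16 * (2 * R l + 1) * period R p l

theorem period_pos {R : ℕ → ℕ} {p : ℕ} (hp : 0 < p) (l : ℕ) : 0 < period R p l := by
  induction l with
  | zero => exact hp
  | succ l ih => rw [period]; positivity

theorem lt_period {R : ℕ → ℕ} {p : ℕ} (hp : 0 < p) (l : ℕ) : l < period R p l := by
  induction l with
  | zero => exact hp
  | succ l ih => rw [period]; nlinarith [Nat.zero_le (R l * period R p l)]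

theorem radius_lt_period {R : ℕ → ℕ} {p : ℕ} (hp : 0 < p) (l : ℕ) :
    2 * R l < period R p (l + 1) := by
  have := period_pos (R := R) hp l
  rw [period]; nlinarith [Nat.zero_le (R l * (period R p l - 1))]

/-- The protected neighbourhoods of the multiples of the `l`-th period. -/
def zone (R : ℕ → ℕ) (p l : ℕ) : Set ℕ := nearMultiples (period R p (l + 1)) (R l)

theorem ncard_zone_le {R : ℕ → ℕ} {p : ℕ} (hp : 0 < p) (l N : ℕ) :
    8 * period R p l * (zone R p l ∩ Set.Icc 1 N).ncard ≤ N := by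
  have h := ncard_nearMultiples_le (radius_lt_period (R := R) hp l) N
  rw [period] at h
  change (zone R p l ∩ Set.Icc 1 N).ncard * _ ≤ _ at h
  refine le_of_mul_le_mul_left (a := 2 * (2 * R l + 1)) ?_ (by omega)
  linarith

theorem ncard_biUnion_zone_le {R : ℕ → ℕ} {p : ℕ} (hp : 0 < p) (N j k : ℕ) :
    4 * period R p k * ({n | ∃ l, k ≤ l ∧ l < k + j ∧ n ∈ zone R p l} ∩ Set.Icc 1 N).ncard ≤ N := by
  induction j generalizing k with
  | zero =>
    have : {n | ∃ l, k ≤ l ∧ l < k + 0 ∧ n ∈ zone R p l} = ∅ :=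
      Set.eq_empty_of_forall_notMem fun n ⟨l, h1, h2, _⟩ => by omega
    rw [this]
    simp
  | succ j ih =>
    have h1 : {n | ∃ l, k ≤ l ∧ l < k + (j + 1) ∧ n ∈ zone R p l} ⊆
        zone R p k ∪ {n | ∃ l, k + 1 ≤ l ∧ l < k + 1 + j ∧ n ∈ zone R p l} := by
      rintro n ⟨l, h1, h2, h3⟩
      rcases h1.eq_or_lt with rfl | h
      · exact Or.inl h3
      · exact Or.inr ⟨l, h, by omega, h3⟩
    have h2 := (ncard_inter_Icc_mono (n := N) (Set.inter_subset_left.trans h1)).trans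
      (ncard_union_inter_Icc_le _ _ _)
    have h3 := ncard_zone_le (R := R) hp k N
    have h4 := ih (k + 1)
    rw [period] at h4
    have h5 : 16 * period R p k *
      ({n | ∃ l, k + 1 ≤ l ∧ l < k + 1 + j ∧ n ∈ zone R p l} ∩ Set.Icc 1 N).ncard ≤ N := by
      refine le_trans ?_ h4
      refine Nat.mul_le_mul_right _ ?_
      nlinarith [Nat.zero_le (R k * period R p k)]
    have h6 := Nat.mul_le_mul_left (4 * period R p k) h2
    linarith

theorem ncard_iUnion_zone_le {R : ℕ → ℕ} {p : ℕ} (hp : 0 < p) (k N : ℕ) :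
    4 * period R p k * ({n | ∃ l, k ≤ l ∧ n ∈ zone R p l} ∩ Set.Icc 1 N).ncard ≤ N := by
  refine le_trans (Nat.mul_le_mul_left _ (ncard_inter_Icc_mono ?_))
    (ncard_biUnion_zone_le (R := R) hp N (N + 1) k)
  rintro n ⟨⟨l, h1, h2⟩, h3⟩
  refine ⟨l, h1, ?_, h2⟩
  by_contra! h
  have h4 := ncard_zone_le (R := R) hp l N
  have h5 : 0 < (zone R p l ∩ Set.Icc 1 N).ncard :=
    (Set.ncard_pos ((Set.finite_Icc 1 N).subset Set.inter_subset_right)).2 ⟨n, h2, h3⟩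
  have h6 := lt_period (R := R) hp l
  nlinarith

/-- Multiples of the `l`-th period that stay away from all later zones. -/
def visitTimes (R : ℕ → ℕ) (p l : ℕ) : Set ℕ :=
  {n | 1 ≤ n ∧ period R p (l + 1) ∣ n ∧ ∀ k, l < k → n ∉ zone R p k}

theorem ncard_visitTimes_ge {R : ℕ → ℕ} {p : ℕ} (hp : 0 < p) (l N : ℕ) :
    3 * N ≤ 4 * period R p (l + 1) * ((visitTimes R p l ∩ Set.Icc 1 N).ncard + 1) := by
  have h1 := ncard_iUnion_zone_le (R := R) hp (l + 1) N
  have h2 := ncard_multiples (period R p (l + 1)) N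
  have h3 : ({m | period R p (l + 1) ∣ m} ∩ Set.Icc 1 N).ncard ≤ _ :=
    (ncard_inter_Icc_mono (B := visitTimes R p l ∪ {n | ∃ k, l + 1 ≤ k ∧ n ∈ zone R p k})
    (by
      rintro n ⟨h3, h4⟩
      by_cases h : ∃ k, l + 1 ≤ k ∧ n ∈ zone R p k
      · exact Or.inr h
      · push Not at h
        exact Or.inl ⟨h4.1, h3, h⟩)).trans (ncard_union_inter_Icc_le _ _ _)
  rw [h2] at h3
  have h4 := Nat.lt_div_mul_add (a := N) (period_pos (R := R) hp (l + 1))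
  nlinarith

theorem visitTimes_separated {R : ℕ → ℕ} {p : ℕ} (hp : 0 < p) {k l m n : ℕ}
    (hm : m ∈ visitTimes R p k) (hn : n ∈ visitTimes R p l) (hne : k = l → m ≠ n) :
    (R (max k l) : ℤ) < |(n : ℤ) - m| := by
  by_contra! h
  rw [abs_le] at h
  rcases lt_trichotomy k l with hkl | rfl | hkl
  · rw [max_eq_right hkl.le] at h
    exact hm.2.2 l hkl ⟨n, hn.1, hn.2.1, by omega, by omega⟩
  · rw [max_self] at h
    have hd : (period R p (k + 1) : ℤ) ∣ (n : ℤ) - m :=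
      dvd_sub (by exact_mod_cast hn.2.1) (by exact_mod_cast hm.2.1)
    have hr := radius_lt_period (R := R) hp k
    have : (n : ℤ) - m = 0 := by
      apply Int.eq_zero_of_abs_lt_dvd hd
      rw [abs_lt]; omega
    exact hne rfl (by omega)
  · rw [max_eq_left hkl.le] at h
    exact hn.2.2 k hkl ⟨m, hm.1, hm.2.1, by omega, by omega⟩

section Vector

variable {X : Type*} [NormedAddCommGroup X]

theorem norm_tsum_indicator_le [CompleteSpace X] {Y : ℤ → X} (hY : Summable Y) {ε : ℝ}
    {s : Finset ℤ} (hs : ∀ t : Finset ℤ, Disjoint t s → ‖∑ i ∈ t, Y i‖ ≤ ε) {A : Set ℤ}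
    (hA : ∀ k ∈ A, k ∉ s) : ‖∑' k, A.indicator Y k‖ ≤ ε := by
  classical
  refine le_of_tendsto (hY.indicator A).hasSum.norm (.of_forall fun t => ?_)
  have h : ∑ k ∈ t, A.indicator Y k = ∑ k ∈ t with k ∈ A, Y k := by
    rw [Finset.sum_filter]; rfl
  rw [h]
  refine hs _ (Finset.disjoint_left.2 fun k hk => hA k (Finset.mem_filter.1 hk).2)

theorem exists_tail_bound [CompleteSpace X] {Y : ℤ → X} (hY : Summable Y) {ε : ℝ} (hε : 0 < ε) :
    ∃ r : ℕ, ∀ A : Set ℤ, (∀ k ∈ A, (r : ℤ) < |k|) → ‖∑' k, A.indicator Y k‖ ≤ ε := by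
  obtain ⟨s, hs⟩ := summable_iff_vanishing_norm.1 hY ε hε
  refine ⟨s.sup Int.natAbs, fun A hA => norm_tsum_indicator_le hY (s := s)
    (fun t ht => (hs t ht).le) fun k hk hks => ?_⟩
  have h1 := hA k hk
  have h2 : k.natAbs ≤ s.sup Int.natAbs := Finset.le_sup (f := Int.natAbs) hks
  rw [Int.abs_eq_natAbs] at h1
  omega

theorem exists_norm_sum_le [CompleteSpace X] {Y : ℤ → X} (hY : Summable Y) :
    ∃ C : ℝ, ∀ t : Finset ℤ, ‖∑ k ∈ t, Y k‖ ≤ C := by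
  classical
  obtain ⟨s, hs⟩ := summable_iff_vanishing_norm.1 hY 1 one_pos
  refine ⟨∑ k ∈ s, ‖Y k‖ + 1, fun t => ?_⟩
  rw [← Finset.sum_inter_add_sum_sdiff t s]
  refine (norm_add_le _ _).trans (add_le_add ?_ (hs _ Finset.sdiff_disjoint).le)
  exact (norm_sum_le _ _).trans
    (Finset.sum_le_sum_of_subset_of_nonneg Finset.inter_subset_right fun _ _ _ => norm_nonneg _)

/-- The shifted sum `∑_{m ∈ A} Y (n - m)`. -/
noncomputable def shiftSum (Y : ℤ → X) (A : Set ℕ) (n : ℤ) : X :=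
  ∑' k, {k : ℤ | ∃ m ∈ A, k = n - m}.indicator Y k

theorem shiftSum_eq_add [CompleteSpace X] {Y : ℤ → X} (hs : Summable Y) {A : Set ℕ} {n : ℕ}
    (hn : n ∈ A) : shiftSum Y A n = Y 0 + shiftSum Y (A \ {n}) n := by
  unfold shiftSum
  rw [(hs.indicator _).tsum_eq_add_tsum_ite 0]
  congr 1
  · exact Set.indicator_of_mem (s := {k : ℤ | ∃ m ∈ A, k = n - m}) ⟨n, hn, by ring⟩ _
  · refine tsum_congr fun k => ?_
    split_ifs with hk
    · rw [Set.indicator_of_notMem]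
      rintro ⟨m, hm, h⟩
      exact hm.2 (by simp only [Set.mem_singleton_iff]; omega)
    · have h : k ∈ {k : ℤ | ∃ m ∈ A, k = n - m} ↔ k ∈ {k : ℤ | ∃ m ∈ A \ {n}, k = n - m} := by
        constructor
        · rintro ⟨m, hm, h⟩
          exact ⟨m, ⟨hm, by simp only [Set.mem_singleton_iff]; omega⟩, h⟩
        · rintro ⟨m, hm, h⟩
          exact ⟨m, hm.1, h⟩
      classical
      simp only [Set.indicator_apply, h]

variable [NormedSpace ℂ X] {T : X →L[ℂ] X} {φ : X →L[ℂ] ℂ}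

theorem pow_apply_orbit {Y : ℤ → X} (hY : ∀ k, T (Y k) = Y (k + 1)) (n : ℕ) (k : ℤ) :
    (T ^ n) (Y k) = Y (k + n) := by
  induction n with
  | zero => simp
  | succ n ih =>
    rw [pow_succ', mul_apply_eq_comp, ih, hY]
    congr 1
    push_cast
    ring

theorem pow_apply_shiftSum [CompleteSpace X] {Y : ℤ → X} (hY : ∀ k, T (Y k) = Y (k + 1))
    (hs : Summable Y) (A : Set ℕ) (n : ℕ) : (T ^ n) (shiftSum Y A 0) = shiftSum Y A n := by
  unfold shiftSum
  rw [ContinuousLinearMap.map_tsum _ (hs.indicator _), 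
    ← (Equiv.addRight (n : ℤ)).tsum_eq ({k : ℤ | ∃ m ∈ A, k = n - m}.indicator Y)]
  refine tsum_congr fun k => ?_
  by_cases h : ∃ m ∈ A, k = 0 - (m : ℤ)
  · rw [Set.indicator_of_mem (by exact h), Set.indicator_of_mem, pow_apply_orbit hY]
    · rfl
    · obtain ⟨m, hm, rfl⟩ := h
      exact ⟨m, hm, by simp only [Equiv.coe_addRight]; ring⟩
  · rw [Set.indicator_of_notMem (by exact h), Set.indicator_of_notMem, map_zero]
    rintro ⟨m, hm, h'⟩
    simp only [Equiv.coe_addRight] at h'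
    exact h ⟨m, hm, by omega⟩

theorem exists_orbit_of_mem_span [CompleteSpace X] {e : ℤ → X} (he : ∀ n, T (e n) = e (n + 1)) (hs : Summable e)
    (hφ : {n | φ (e n) ≠ 0}.Finite) {y : X} (hy : y ∈ Submodule.span ℂ (Set.range e)) :
    ∃ Y : ℤ → X, Y 0 = y ∧ (∀ k, T (Y k) = Y (k + 1)) ∧ Summable Y ∧ {k | φ (Y k) ≠ 0}.Finite := by
  induction hy using Submodule.span_induction with
  | mem y hy =>
    obtain ⟨n, rfl⟩ := hy
    refine ⟨fun k => e (n + k), by simp, fun k => by rw [he, add_assoc],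
      hs.comp_injective (add_right_injective n), ?_⟩
    exact hφ.preimage (f := fun k => n + k) (add_right_injective n).injOn
  | zero => exact ⟨0, rfl, fun k => map_zero T, summable_zero, by simp⟩
  | add y z _ _ hy hz =>
    obtain ⟨Y, rfl, hY, hYs, hYf⟩ := hy
    obtain ⟨Z, rfl, hZ, hZs, hZf⟩ := hz
    refine ⟨Y + Z, rfl, fun k => by simp [hY, hZ], hYs.add hZs, (hYf.union hZf).subset ?_⟩
    intro k hk
    by_contra h
    simp only [Set.mem_union, Set.mem_ofPred_eq, not_or, not_not] at h
    exact hk (by simp [h.1, h.2])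
  | smul a y _ hy =>
    obtain ⟨Y, rfl, hY, hYs, hYf⟩ := hy
    refine ⟨a • Y, rfl, fun k => by simp [hY], hYs.const_smul a, hYf.subset ?_⟩
    intro k hk h
    exact hk (by simp [h])

theorem exists_radii [CompleteSpace X] {Y : ℕ → ℤ → X} (hs : ∀ l, Summable (Y l))
    (hφ : ∀ l, {k | φ (Y l k) ≠ 0}.Finite) :
    ∃ R : ℕ → ℕ, (∀ l' l, l' ≤ l → ∀ A : Set ℤ, (∀ k ∈ A, (R l : ℤ) < |k|) →
      ‖∑' k, A.indicator (Y l') k‖ ≤ (1 / 2) ^ l) ∧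
      ∀ l k, (R l : ℤ) < |k| → φ (Y l k) = 0 := by
  choose r hr using fun l' l => exists_tail_bound (hs l') (ε := (1 / 2) ^ l) (by positivity)
  refine ⟨fun l => (Finset.range (l + 1)).sup (fun l' => r l' l) +
    (hφ l).toFinset.sup Int.natAbs, fun l' l hl A hA => hr l' l A fun k hk => ?_, fun l k hk => ?_⟩
  · have h1 : r l' l ≤ (Finset.range (l + 1)).sup (fun l' => r l' l) :=
      Finset.le_sup (f := fun l' => r l' l) (Finset.mem_range.2 (by omega))
    have := hA k hk
    push_cast at this
    omega
  · by_contra h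
    have h1 : k.natAbs ≤ (hφ l).toFinset.sup Int.natAbs :=
      Finset.le_sup (f := Int.natAbs) ((hφ l).mem_toFinset.2 h)
    push_cast at hk
    rw [Int.abs_eq_natAbs] at hk
    omega

theorem exists_frequently_visiting [CompleteSpace X] {Y : ℕ → ℤ → X}
    (hY : ∀ l k, T (Y l k) = Y l (k + 1)) (hs : ∀ l, Summable (Y l))
    (hφ : ∀ l, {k | φ (Y l k) ≠ 0}.Finite) {p : ℕ} (hp : 0 < p) :
    ∃ (x : X) (R : ℕ → ℕ),
      (∀ l, ∀ n ∈ visitTimes R p l, ‖(T ^ n) x - Y l 0‖ ≤ (l + 3) * (1 / 2) ^ l) ∧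
      ∀ n, (∀ l, n ∉ zone R p l) → φ ((T ^ n) x) = 0 := by
  obtain ⟨R, hR, hRφ⟩ := exists_radii hs hφ
  have hgeo : Summable fun l : ℕ => ((1 : ℝ) / 2) ^ l := summable_geometric_two
  have h0 : ∀ l, ‖shiftSum (Y l) (visitTimes R p l) 0‖ ≤ (1 / 2) ^ l := by
    intro l
    refine hR l l le_rfl _ ?_
    rintro k ⟨m, hm, rfl⟩
    have h1 := Nat.le_of_dvd hm.1 hm.2.1
    have h2 := radius_lt_period (R := R) hp l
    rw [zero_sub, abs_neg, Nat.abs_cast]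
    omega
  have hsum0 := Summable.of_norm_bounded hgeo h0
  have hTn : ∀ n : ℕ, (T ^ n) (∑' l, shiftSum (Y l) (visitTimes R p l) 0) =
      ∑' l, shiftSum (Y l) (visitTimes R p l) n := fun n => by
    rw [ContinuousLinearMap.map_tsum _ hsum0]
    exact tsum_congr fun l => pow_apply_shiftSum (hY l) (hs l) _ n
  have hsumn : ∀ n : ℕ, Summable fun l => shiftSum (Y l) (visitTimes R p l) n := fun n => by
    refine ((T ^ n).summable hsum0).congr fun l => ?_
    exact pow_apply_shiftSum (hY l) (hs l) _ n
  refine ⟨∑' l, shiftSum (Y l) (visitTimes R p l) 0, R, fun l n hn => ?_, fun n hn => ?_⟩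
  · let f : ℕ → X := fun k =>
      shiftSum (Y k) (if k = l then visitTimes R p l \ {n} else visitTimes R p k) n
    have hf : ∀ k, ‖f k‖ ≤ (1 / 2) ^ max k l := by
      intro k
      refine hR k (max k l) (le_max_left _ _) _ ?_
      rintro _ ⟨m, hm, rfl⟩
      refine visitTimes_separated hp (k := k) ?_ hn ?_
      · split_ifs at hm with h
        · exact h ▸ hm.1
        · exact hm
      · intro h
        rw [if_pos h] at hm
        exact hm.2
    have hfs : Summable f := Summable.of_norm_bounded hgeo fun k => (hf k).trans
      (pow_le_pow_of_le_one (by norm_num) (by norm_num) (le_max_left _ _))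
    have hdiff : (T ^ n) (∑' l, shiftSum (Y l) (visitTimes R p l) 0) - Y l 0 = ∑' k, f k := by
      rw [hTn, (hsumn n).tsum_eq_add_tsum_ite l, hfs.tsum_eq_add_tsum_ite l,
        shiftSum_eq_add (hs l) hn]
      have : ∀ k, (if k = l then 0 else shiftSum (Y k) (visitTimes R p k) n) =
          if k = l then 0 else f k := fun k => by
        split_ifs with h
        · rfl
        · simp [f, h]
      simp only [this, f, if_true]
      abel
    rw [hdiff, ← hfs.sum_add_tsum_nat_add l]
    refine (norm_add_le _ _).trans ?_
    have h1 : ‖∑ k ∈ Finset.range l, f k‖ ≤ l * (1 / 2) ^ l := by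
      refine (norm_sum_le_of_le _ (f := f) (n := fun _ => (1 / 2) ^ l) fun k hk => ?_).trans
        (by simp)
      have := hf k
      rwa [max_eq_right (Finset.mem_range.1 hk).le] at this
    have h2 : ‖∑' k, f (k + l)‖ ≤ 2 * (1 / 2) ^ l := by
      refine tsum_of_norm_bounded (hasSum_geometric_two.mul_right _) fun k => ?_
      have := hf (k + l)
      rwa [max_eq_left (by omega), pow_add] at this
    have h3 : (0 : ℝ) < (1 / 2) ^ l := by positivity
    linarith
  · rw [hTn, ContinuousLinearMap.map_tsum _ (hsumn n)]
    refine (tsum_congr fun l => ?_).trans tsum_zero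
    unfold shiftSum
    rw [ContinuousLinearMap.map_tsum _ ((hs l).indicator _)]
    refine (tsum_congr fun k => ?_).trans tsum_zero
    by_cases h : ∃ m ∈ visitTimes R p l, k = (n : ℤ) - m
    · rw [Set.indicator_of_mem (by exact h)]
      refine hRφ l k ?_
      obtain ⟨m, hm, rfl⟩ := h
      by_contra! h
      rw [abs_le] at h
      exact hn l ⟨m, hm.1, hm.2.1, by omega, by omega⟩
    · rw [Set.indicator_of_notMem (by exact h), map_zero]

/-- The multiples of `p` in the interval from `(2 * i)!` to `(2 * i + 1)!`. -/
def block (p i : ℕ) : Finset ℕ :=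
  {m ∈ Finset.Ioc (2 * i).factorial (2 * i + 1).factorial | p ∣ m}

theorem eq_of_mem_block {p i j n : ℕ} (hi : n ∈ block p i) (hj : n ∈ block p j) : i = j := by
  simp only [block, Finset.mem_filter, Finset.mem_Ioc] at hi hj
  by_contra hne
  rcases Nat.lt_or_gt_of_ne hne with h | h
  · have := Nat.factorial_le (show 2 * i + 1 ≤ 2 * j by omega)
    omega
  · have := Nat.factorial_le (show 2 * j + 1 ≤ 2 * i by omega)
    omega

theorem exists_block_perturbation [CompleteSpace X] {e : ℤ → X} (he : ∀ n, T (e n) = e (n + 1))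
    (hs : Summable e) {j : ℤ} {p : ℕ} (hj : φ (e j) ≠ 0) (hlow : ∀ k < j, φ (e k) = 0)
    (hhigh : ∀ k, j + p ≤ k → φ (e k) = 0) :
    ∃ v : X, Tendsto (fun n : ℕ => (T ^ n) v) atTop (𝓝 0) ∧
      (∀ i, ∀ n ∈ block p i, 0 < (φ ((T ^ n) v)).re) ∧
      ∀ n, (∀ i, ∀ m ∈ block p i, m ≤ n → n < m + p → False) → φ ((T ^ n) v) = 0 := by
  obtain ⟨C, hC⟩ := exists_norm_sum_le hs
  let c : ℂ := (starRingEnd ℂ) (φ (e j))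
  let w : ℕ → ℤ → X := fun i n => ((1 / 2 : ℂ) ^ i) • c • ∑ m ∈ block p i, e (j + n - m)
  have hwT : ∀ i (n : ℕ), (T ^ n) (w i 0) = w i n := fun i n => by
    simp only [w, map_smul, map_sum, pow_apply_orbit he]
    congr 2
    refine Finset.sum_congr rfl fun m _ => ?_
    congr 1
    ring
  have hwb : ∀ i (n : ℤ), ‖w i n‖ ≤ (1 / 2) ^ i * (‖c‖ * C) := fun i n => by
    simp only [w, norm_smul, norm_pow]
    have h1 : ‖∑ m ∈ block p i, e (j + n - m)‖ ≤ C := by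
      have := hC ((block p i).image fun m : ℕ => j + n - m)
      rwa [Finset.sum_image (by intro a _ b _ h; simpa using h)] at this
    have h2 : ‖(1 / 2 : ℂ)‖ = 1 / 2 := by norm_num
    rw [h2]
    gcongr
  have hbound : Summable fun i : ℕ => ((1 : ℝ) / 2) ^ i * (‖c‖ * C) :=
    summable_geometric_two.mul_right _
  have hws : ∀ n, Summable fun i => w i n := fun n =>
    Summable.of_norm_bounded hbound fun i => hwb i n
  have hTn : ∀ n : ℕ, (T ^ n) (∑' i, w i 0) = ∑' i, w i n := fun n => by
    rw [ContinuousLinearMap.map_tsum _ (hws 0)]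
    exact tsum_congr fun i => hwT i n
  have hφw : ∀ i (n : ℕ), (∀ m ∈ block p i, m ≤ n → n < m + p → False) → φ (w i n) = 0 := by
    intro i n h
    have : ∑ m ∈ block p i, φ (e (j + n - m)) = 0 := Finset.sum_eq_zero fun m hm => by
      rcases lt_or_ge n m with h1 | h1
      · exact hlow _ (by omega)
      · exact hhigh _ (by have := not_lt.1 (h m hm h1); omega)
    simp [w, map_sum, this]
  refine ⟨∑' i, w i 0, ?_, fun i n hn => ?_, fun n hn => ?_⟩
  · simp only [hTn]
    rw [← tsum_zero (α := X) (β := ℕ)]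
    refine tendsto_tsum_of_dominated_convergence hbound (fun i => ?_)
      (.of_forall fun n i => hwb i n)
    have h1 : ∀ m : ℕ, Tendsto (fun n : ℕ => e (j + n - m)) atTop (𝓝 0) := fun m => by
      rw [← Nat.cofinite_eq_atTop]
      refine hs.tendsto_cofinite_zero.comp (Function.Injective.tendsto_cofinite ?_)
      intro a b h
      simpa using h
    have h2 := ((tendsto_finsetSum (block p i) fun m _ => h1 m).const_smul c).const_smul
      ((1 / 2 : ℂ) ^ i)
    simpa [w] using h2
  · have hclose : ∀ i', ∀ m ∈ block p i', m ≤ n → n < m + p → m = n := fun i' m hm h1 h2 => by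
      have hd := Nat.dvd_sub (Finset.mem_filter.1 hn).2 (Finset.mem_filter.1 hm).2
      have := Nat.eq_zero_of_dvd_of_lt hd (by omega)
      omega
    rw [hTn, ContinuousLinearMap.map_tsum _ (hws n), tsum_eq_single i]
    · have h1 : ∑ m ∈ block p i, φ (e (j + n - m)) = φ (e j) := by
        rw [Finset.sum_eq_single_of_mem n hn]
        · simp
        · intro m hm hmn
          rcases lt_or_ge n m with h1 | h1
          · exact hlow _ (by omega)
          · exact hhigh _ (by
              by_contra! h
              exact hmn (hclose i m hm h1 (by omega)))
      have h2 : φ (w i n) = (((1 / 2 : ℝ) ^ i * Complex.normSq (φ (e j)) : ℝ) : ℂ) := by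
        simp only [w, map_smul, map_sum, h1, smul_eq_mul, c]
        rw [mul_comm ((starRingEnd ℂ) _), Complex.mul_conj]
        push_cast
        rfl
      rw [h2, Complex.ofReal_re]
      have := Complex.normSq_pos.2 hj
      positivity
    · intro i' hi'
      refine hφw i' n fun m hm h1 h2 => hi' ?_
      exact eq_of_mem_block (hclose i' m hm h1 h2 ▸ hm) hn
  · rw [hTn, ContinuousLinearMap.map_tsum _ (hws n)]
    exact (tsum_congr fun i => hφw i n (hn i)).trans tsum_zero

end Vector

theorem exists_first_nonvanishing {X : Type*} [NormedAddCommGroup X] [NormedSpace ℂ X]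
    {e : ℤ → X} (hspan : Dense (Submodule.span ℂ (Set.range e) : Set X)) {φ : X →L[ℂ] ℂ}
    (hφ : φ ≠ 0) {F : Finset ℤ} (hF : ∀ n, n ∉ F → φ (e n) = 0) :
    ∃ (j : ℤ) (p : ℕ), 0 < p ∧ φ (e j) ≠ 0 ∧ (∀ k < j, φ (e k) = 0) ∧
      ∀ k, j + p ≤ k → φ (e k) = 0 := by
  classical
  have hne : (F.filter fun n => φ (e n) ≠ 0).Nonempty := by
    by_contra h
    refine hφ (ContinuousLinearMap.ext_on hspan ?_)
    rintro _ ⟨n, rfl⟩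
    by_contra hn
    exact h ⟨n, Finset.mem_filter.2 ⟨by_contra fun hnF => hn (hF n hnF), hn⟩⟩
  set G := F.filter fun n => φ (e n) ≠ 0
  have hG : ∀ n, n ∉ G → φ (e n) = 0 := fun n hn => by
    by_contra h
    exact hn (Finset.mem_filter.2 ⟨by_contra fun hnF => h (hF n hnF), h⟩)
  have hle := G.min'_le_max' hne
  refine ⟨G.min' hne, (G.max' hne + 1 - G.min' hne).toNat, by omega,
    (Finset.mem_filter.1 (G.min'_mem hne)).2, fun k hk => hG k fun h => ?_,
    fun k hk => hG k fun h => ?_⟩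
  · exact absurd (G.min'_le k h) (by omega)
  · exact absurd (G.le_max' k h) (by omega)

theorem lowerDensity_le_of_blocks {S D : Set ℕ} {p : ℕ} (hp : 0 < p)
    (hD : ∀ N, 4 * p * (D ∩ Set.Icc 1 N).ncard ≤ N)
    (hS : ∀ n ∈ S, n ∉ D → ∃ i, ∃ m ∈ block p i, m ≤ n ∧ n < m + p) :
    lowerDensity S ≤ 3 / (8 * p) := by
  have hp' : (0 : ℝ) < p := by exact_mod_cast hp
  refine lowerDensity_le (frequently_atTop.2 fun a => ?_)
  let k := a + 16 * p
  refine ⟨(2 * k + 2).factorial, (by omega : a ≤ 2 * k + 2).trans (Nat.self_le_factorial _), ?_⟩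
  have hfac : (2 * k + 2).factorial = (2 * k + 2) * (2 * k + 1).factorial := Nat.factorial_succ _
  have hself := Nat.self_le_factorial (2 * k + 1)
  set M := (2 * k + 1).factorial
  set N := (2 * k + 2).factorial
  have h1 : (S ∩ Set.Icc 1 N).ncard ≤ (D ∩ Set.Icc 1 N).ncard + (M + p) := by
    refine (ncard_inter_Icc_mono (B := D ∪ Set.Iic (M + p)) ?_).trans
      ((ncard_union_inter_Icc_le _ _ _).trans
        (Nat.add_le_add_left (ncard_Iic_inter_Icc_le _ _) _))
    rintro n ⟨hn, -, hnN⟩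
    by_cases hnD : n ∈ D
    · exact Or.inl hnD
    · obtain ⟨i, m, hm, h1, h2⟩ := hS n hn hnD
      simp only [block, Finset.mem_filter, Finset.mem_Ioc] at hm
      have h3 : 2 * i < 2 * k + 2 := by
        by_contra! h
        have := Nat.factorial_le h
        omega
      have h4 : (2 * i + 1).factorial ≤ M := Nat.factorial_le (by omega)
      exact Or.inr (by simp only [Set.mem_Iic]; omega)
  have h2 : 16 * p * M ≤ N := by
    rw [hfac]; exact Nat.mul_le_mul_right _ (by omega)
  have h3 : 16 * p * p ≤ N := (Nat.mul_le_mul_left _ (by omega : p ≤ M)).trans h2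
  have h4 := hD N
  have h5 : 8 * p * (S ∩ Set.Icc 1 N).ncard ≤ 3 * N := by nlinarith
  have hN : (0 : ℝ) < N := by exact_mod_cast Nat.factorial_pos _
  unfold partialDensity
  rw [div_le_div_iff₀ hN (by positivity)]
  have h6 : (8 : ℝ) * p * (S ∩ Set.Icc 1 N).ncard ≤ 3 * N := by exact_mod_cast h5
  linarith

theorem le_upperDensity_of_blocks {S D : Set ℕ} {p : ℕ} (hp : 0 < p)
    (hD : ∀ N, 4 * p * (D ∩ Set.Icc 1 N).ncard ≤ N)
    (hS : ∀ i, ∀ n ∈ block p i, n ∉ D → n ∈ S) :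
    1 / (2 * p) ≤ upperDensity S := by
  have hp' : (0 : ℝ) < p := by exact_mod_cast hp
  refine le_upperDensity (frequently_atTop.2 fun a => ?_)
  let k := a + 16 * p
  refine ⟨(2 * k + 1).factorial, (by omega : a ≤ 2 * k + 1).trans (Nat.self_le_factorial _), ?_⟩
  have hfac : (2 * k + 1).factorial = (2 * k + 1) * (2 * k).factorial := Nat.factorial_succ _
  have hself := Nat.self_le_factorial (2 * k)
  set M := (2 * k).factorial
  set N := (2 * k + 1).factorial
  have h1 : N / p ≤ (S ∩ Set.Icc 1 N).ncard + (D ∩ Set.Icc 1 N).ncard + M := by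
    rw [← ncard_multiples p N]
    refine (ncard_inter_Icc_mono (B := (S ∪ D) ∪ Set.Iic M) ?_).trans
      ((ncard_union_inter_Icc_le _ _ _).trans
        (add_le_add (ncard_union_inter_Icc_le _ _ _) (ncard_Iic_inter_Icc_le _ _)))
    rintro n ⟨hn, -, hnN⟩
    rcases le_or_gt n M with h | h
    · exact Or.inr h
    · by_cases hnD : n ∈ D
      · exact Or.inl (Or.inr hnD)
      · exact Or.inl (Or.inl (hS k n
          (Finset.mem_filter.2 ⟨Finset.mem_Ioc.2 ⟨h, hnN⟩, hn⟩) hnD))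
  have h2 : 16 * p * M ≤ N := by
    rw [hfac]; exact Nat.mul_le_mul_right _ (by omega)
  have h3 : 16 * p * p ≤ N := (Nat.mul_le_mul_left _ (by omega : p ≤ M)).trans h2
  have h4 := hD N
  have h5 := Nat.lt_div_mul_add (a := N) hp
  have h6 : N ≤ 2 * p * (S ∩ Set.Icc 1 N).ncard := by nlinarith
  have hN : (0 : ℝ) < N := by exact_mod_cast Nat.factorial_pos _
  unfold partialDensity
  rw [div_le_div_iff₀ (by positivity) hN]
  have h7 : (N : ℝ) ≤ 2 * p * (S ∩ Set.Icc 1 N).ncard := by exact_mod_cast h6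
  linarith

/-- **Theorem 1.** Let `T` be a bounded operator on a separable infinite-dimensional complex
Banach space `X` admitting a bicyclic vector `x₀` (with associated family `e : ℤ → X`,
`e n = Tⁿx₀`) such that the series `∑_{n∈ℤ} T^{-n}x₀` is unconditionally convergent, and such
that there is a nonzero functional `φ` with `⟨φ, Tⁿx₀⟩ = 0` for all `n` outside a finite set
`F`.  Then `T` has a frequently hypercyclic vector `x` whose orbit visits
`U₀ = {y | Re⟨φ, y⟩ > 0}` irregularly. -/
theorem stmt_0 {X : Type*} [NormedAddCommGroup X] [NormedSpace ℂ X] [CompleteSpace X]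
    [TopologicalSpace.SeparableSpace X] (hdim : ¬ FiniteDimensional ℂ X)
    (T : X →L[ℂ] X) (x₀ : X) (e : ℤ → X) (he0 : e 0 = x₀)
    (hTe : ∀ n : ℤ, T (e n) = e (n + 1))
    (hspan : Dense (Submodule.span ℂ (Set.range e) : Set X))
    (hsum : Summable (fun n : ℤ => e (-n)))
    (φ : X →L[ℂ] ℂ) (hφ : φ ≠ 0) (F : Finset ℤ)
    (hF : ∀ n : ℤ, n ∉ F → φ (e n) = 0) :
    ∃ x : X,
      (∀ U : Set X, IsOpen U → U.Nonempty →
        0 < lowerDensity {n : ℕ | 1 ≤ n ∧ (T ^ n) x ∈ U}) ∧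
      lowerDensity {n : ℕ | 1 ≤ n ∧ (T ^ n) x ∈ {y : X | 0 < (φ y).re}} <
        upperDensity {n : ℕ | 1 ≤ n ∧ (T ^ n) x ∈ {y : X | 0 < (φ y).re}} := by
  classical
  have hs : Summable e := by
    refine (hsum.comp_injective neg_injective).congr fun n => ?_
    simp
  have hφe : {n | φ (e n) ≠ 0}.Finite :=
    F.finite_toSet.subset fun n hn => by_contra fun h => hn (hF n h)
  obtain ⟨j, p, hp, hj, hlow, hhigh⟩ := exists_first_nonvanishing hspan hφ hF
  obtain ⟨v, hv0, hvpos, hvzero⟩ := exists_block_perturbation hTe hs hj hlow hhigh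
  have : SecondCountableTopology X := UniformSpace.secondCountable_of_separable X
  obtain ⟨t, htsub, htc, htd⟩ := hspan.exists_countable_dense_subset
  obtain ⟨y, rfl⟩ := htc.exists_eq_range htd.nonempty
  choose Y hY0 hYT hYs hYφ using fun i =>
    exists_orbit_of_mem_span hTe hs hφe (htsub (Set.mem_range_self i))
  obtain ⟨x, R, hx, hxzero⟩ := exists_frequently_visiting
    (Y := fun l => Y (Nat.unpair l).1) (fun l => hYT _) (fun l => hYs _) (fun l => hYφ _) hp
  refine ⟨x + v, fun U hU hUne => ?_, ?_⟩
  · obtain ⟨_, ⟨i, rfl⟩, hiU⟩ := htd.exists_mem_open hU hUne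
    obtain ⟨ε, hε, hball⟩ := Metric.isOpen_iff.1 hU _ hiU
    have hlim : Tendsto (fun l : ℕ => ((l : ℝ) + 3) * (1 / 2) ^ l) atTop (𝓝 0) := by
      have h1 := tendsto_self_mul_const_pow_of_lt_one (r := (1 / 2 : ℝ)) (by norm_num)
        (by norm_num)
      have h2 := (tendsto_pow_atTop_nhds_zero_of_lt_one (r := (1 / 2 : ℝ)) (by norm_num)
        (by norm_num)).const_mul 3
      simpa [add_mul] using h1.add h2
    obtain ⟨b, hb⟩ := eventually_atTop.1 (hlim.eventually_lt_const (half_pos hε))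
    obtain ⟨n₀, hn₀⟩ := Metric.tendsto_atTop.1 hv0 (ε / 2) (half_pos hε)
    refine lowerDensity_pos (period_pos (R := R) hp (Nat.pair i b + 1)) (n₀ := n₀)
      (ncard_visitTimes_ge hp (Nat.pair i b)) fun n hn hnn => ⟨hn.1, hball ?_⟩
    have h1 := hx _ n hn
    have h2 := hb _ (Nat.right_le_pair i b)
    have h3 := hn₀ n hnn
    simp only [Nat.unpair_pair, hY0] at h1
    rw [dist_zero_right] at h3
    rw [Metric.mem_ball, dist_eq_norm, map_add, add_sub_right_comm]
    exact (norm_add_le _ _).trans_lt (by linarith)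
  · set D : Set ℕ := {n | ∃ l, 0 ≤ l ∧ n ∈ zone R p l}
    have hD : ∀ N, 4 * p * (D ∩ Set.Icc 1 N).ncard ≤ N := fun N =>
      ncard_iUnion_zone_le (R := R) hp 0 N
    have hφn : ∀ n, n ∉ D → φ ((T ^ n) (x + v)) = φ ((T ^ n) v) := fun n hn => by
      rw [map_add, map_add, hxzero n fun l hl => hn ⟨l, l.zero_le, hl⟩, zero_add]
    refine (lowerDensity_le_of_blocks hp hD ?_).trans_lt
      (lt_of_lt_of_le ?_ (le_upperDensity_of_blocks hp hD ?_))
    · rintro n ⟨-, hn⟩ hnD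
      by_contra! h
      rw [Set.mem_ofPred_eq, hφn n hnD,
        hvzero n fun i m hm h1 h2 => absurd h2 (not_lt.2 (h i m hm h1))] at hn
      simp at hn
    · have hp' : (0 : ℝ) < p := by exact_mod_cast hp
      rw [div_lt_div_iff₀ (by positivity) (by positivity)]
      linarith
    · intro i n hn hnD
      refine ⟨?_, ?_⟩
      · have := (Finset.mem_Ioc.1 (Finset.mem_filter.1 hn).1).1
        omega
      · rw [Set.mem_ofPred_eq, hφn n hnD]
        exact hvpos i n hn
end

section
/- Fix integers d ≥ 1 and p ≥ 1 such that 2^{s+1+p} ≥ 2^{s+1} + 2d + 1 for every s ≥ 1. For s ≥ 1 and j ≥ 2s+p+2, let I_j^{(s)} = [2^{j+1} − 2^{j−s+1}, 2^{j+1} − 2^{j−s}) (an interval of integers), let L_j^{(s)} = { i ∈ I_j^{(s)} : dist(i, ℕ∖I_j^{(s)}) ≥ 2^{s+1+p} and 2^{s+1+p} divides i }, and let Δ_s = ⋃_{j≥2s+p+2} L_j^{(s)}. Then: (1) min Δ_s ≥ 2^{2s+p+2}, so in particular min Δ_s ≥ 2^{s+1}; (2) any two distinct i, i' ∈ Δ_s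 satisfy |i−i'| ≥ 2^{s+1+p} ≥ 2^{s+1}+2d+1; (3) for s ≠ s', any i ∈ Δ_s and i' ∈ Δ_{s'} satisfy |i−i'| ≥ 2^{max(s,s')+1+p} ≥ 2^{max(s,s')+1}+2d+1; in particular the sets Δ_s, s ≥ 1, are pairwise disjoint. -/
open Filter Topology

/-- The interval `I_j^{(s)} = [2^{j+1} − 2^{j−s+1}, 2^{j+1} − 2^{j−s})` of natural numbers. -/
def Iset (s j : ℕ) : Set ℕ := Set.Ico (2 ^ (j + 1) - 2 ^ (j - s + 1)) (2 ^ (j + 1) - 2 ^ (j - s))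

/-- `L_j^{(s)} = { i ∈ I_j^{(s)} : dist(i, ℕ∖I_j^{(s)}) ≥ 2^{s+1+p} and 2^{s+1+p} ∣ i }`. -/
def Lset (p s j : ℕ) : Set ℕ :=
  {i | i ∈ Iset s j ∧ (∀ m : ℕ, m ∉ Iset s j → (2 : ℤ) ^ (s + 1 + p) ≤ |(i : ℤ) - (m : ℤ)|) ∧
    2 ^ (s + 1 + p) ∣ i}

/-- `Δ_s = ⋃_{j ≥ 2s+p+2} L_j^{(s)}`. -/
def Dlt (p s : ℕ) : Set ℕ := {i | ∃ j : ℕ, 2 * s + p + 2 ≤ j ∧ i ∈ Lset p s j}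

/-- `D_s = ⋃_{j ≥ 2s+p+2, j ∈ J} L_j^{(s)}`, where `J = 5ℕ ∪ (5ℕ+2)`. -/
def Dset (p s : ℕ) : Set ℕ :=
  {i | ∃ j : ℕ, 2 * s + p + 2 ≤ j ∧ (j % 5 = 0 ∨ j % 5 = 2) ∧ i ∈ Lset p s j}

theorem Iset_subset_dyadic {s j i : ℕ} (hs : 1 ≤ s) (hj : s ≤ j) (hi : i ∈ Iset s j) :
    2 ^ j ≤ i ∧ i < 2 ^ (j + 1) := by
  obtain ⟨hl, hu⟩ := hi
  have hpow : 2 ^ (j - s + 1) ≤ 2 ^ j := Nat.pow_le_pow_right two_pos (by omega)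
  rw [pow_succ] at hl hu ⊢
  omega

theorem disjoint_Iset {s s' j j' : ℕ} (hs : 1 ≤ s) (hss : s < s') (hj : s ≤ j) (hj' : s' ≤ j') :
    Disjoint (Iset s j) (Iset s' j') := by
  rw [Set.disjoint_left]
  intro i hi hi'
  obtain ⟨h1, h2⟩ := Iset_subset_dyadic hs hj hi
  obtain ⟨h3, h4⟩ := Iset_subset_dyadic (hs.trans hss.le) hj' hi'
  have hlt : j < j' + 1 := (Nat.pow_lt_pow_iff_right one_lt_two).1 (h1.trans_lt h4)
  have hlt' : j' < j + 1 := (Nat.pow_lt_pow_iff_right one_lt_two).1 (h3.trans_lt h2)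
  obtain rfl : j = j' := by omega
  have hu : i < 2 ^ (j + 1) - 2 ^ (j - s) := hi.2
  have hl : 2 ^ (j + 1) - 2 ^ (j - s' + 1) ≤ i := hi'.1
  have hpow : 2 ^ (j - s' + 1) ≤ 2 ^ (j - s) := Nat.pow_le_pow_right two_pos (by omega)
  omega

theorem two_pow_le_of_mem_Dlt {p s i : ℕ} (hs : 1 ≤ s) (hi : i ∈ Dlt p s) :
    2 ^ (2 * s + p + 2) ≤ i := by
  obtain ⟨j, hj, hi, -⟩ := hi
  exact (Nat.pow_le_pow_right two_pos hj).trans (Iset_subset_dyadic hs (by omega) hi).1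

theorem two_pow_dvd_of_mem_Dlt {p s i : ℕ} (hi : i ∈ Dlt p s) : 2 ^ (s + 1 + p) ∣ i := by
  obtain ⟨j, -, -, -, h⟩ := hi
  exact h

theorem two_pow_le_abs_sub_of_mem_Dlt {p s i i' : ℕ} (hi : i ∈ Dlt p s) (hi' : i' ∈ Dlt p s)
    (hne : i ≠ i') : (2 : ℤ) ^ (s + 1 + p) ≤ |(i : ℤ) - (i' : ℤ)| := by
  refine Int.le_of_dvd (abs_pos.2 (sub_ne_zero.2 (by exact_mod_cast hne))) ((dvd_abs _ _).2 ?_)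
  exact dvd_sub (by exact_mod_cast two_pow_dvd_of_mem_Dlt hi)
    (by exact_mod_cast two_pow_dvd_of_mem_Dlt hi')

theorem two_pow_le_abs_sub_of_mem_Dlt_of_lt {p s s' i i' : ℕ} (hs : 1 ≤ s) (hss : s < s')
    (hi : i ∈ Dlt p s) (hi' : i' ∈ Dlt p s') :
    (2 : ℤ) ^ (s' + 1 + p) ≤ |(i : ℤ) - (i' : ℤ)| := by
  obtain ⟨j, hj, hi, -⟩ := hi
  obtain ⟨j', hj', -, hd, -⟩ := hi'
  rw [abs_sub_comm]
  exact hd i (Set.disjoint_left.1 (disjoint_Iset hs hss (by omega) (by omega)) hi)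

theorem two_pow_max_le_abs_sub_of_mem_Dlt {p s s' i i' : ℕ} (hs : 1 ≤ s) (hs' : 1 ≤ s')
    (hne : s ≠ s') (hi : i ∈ Dlt p s) (hi' : i' ∈ Dlt p s') :
    (2 : ℤ) ^ (max s s' + 1 + p) ≤ |(i : ℤ) - (i' : ℤ)| := by
  rcases hne.lt_or_gt with h | h
  · rw [max_eq_right h.le]
    exact two_pow_le_abs_sub_of_mem_Dlt_of_lt hs h hi hi'
  · rw [max_eq_left h.le, abs_sub_comm]
    exact two_pow_le_abs_sub_of_mem_Dlt_of_lt hs' h hi' hi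

/-- The sets `Δ_s` satisfy: (1) `min Δ_s ≥ 2^{2s+p+2} ≥ 2^{s+1}`; (2) distinct elements of `Δ_s`
are at distance at least `2^{s+1+p} ≥ 2^{s+1}+2d+1`; (3) elements of `Δ_s` and `Δ_{s'}` for
`s ≠ s'` are at distance at least `2^{max(s,s')+1+p} ≥ 2^{max(s,s')+1}+2d+1`; in particular the
sets `Δ_s`, `s ≥ 1`, are pairwise disjoint. -/
theorem stmt_11 (d p : ℕ) (hd : 1 ≤ d) (hp : 1 ≤ p)
    (hdp : ∀ s : ℕ, 1 ≤ s → 2 ^ (s + 1) + 2 * d + 1 ≤ 2 ^ (s + 1 + p)) :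
    (∀ s : ℕ, 1 ≤ s → ∀ i ∈ Dlt p s, 2 ^ (2 * s + p + 2) ≤ i ∧ 2 ^ (s + 1) ≤ i) ∧
    (∀ s : ℕ, 1 ≤ s → ∀ i ∈ Dlt p s, ∀ i' ∈ Dlt p s, i ≠ i' →
      (2 : ℤ) ^ (s + 1 + p) ≤ |(i : ℤ) - (i' : ℤ)| ∧
      (2 : ℤ) ^ (s + 1) + 2 * d + 1 ≤ |(i : ℤ) - (i' : ℤ)|) ∧
    (∀ s s' : ℕ, 1 ≤ s → 1 ≤ s' → s ≠ s' → ∀ i ∈ Dlt p s, ∀ i' ∈ Dlt p s',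
      (2 : ℤ) ^ (max s s' + 1 + p) ≤ |(i : ℤ) - (i' : ℤ)| ∧
      (2 : ℤ) ^ (max s s' + 1) + 2 * d + 1 ≤ |(i : ℤ) - (i' : ℤ)|) ∧
    (∀ s s' : ℕ, 1 ≤ s → 1 ≤ s' → s ≠ s' → Disjoint (Dlt p s) (Dlt p s')) := by
  have hgap : ∀ s : ℕ, 1 ≤ s → (2 : ℤ) ^ (s + 1) + 2 * d + 1 ≤ 2 ^ (s + 1 + p) :=
    fun s hs => by exact_mod_cast hdp s hs
  refine ⟨fun s hs i hi => ?_, fun s hs i hi i' hi' hne => ?_,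
    fun s s' hs hs' hne i hi i' hi' => ?_, fun s s' hs hs' hne => ?_⟩
  · have h := two_pow_le_of_mem_Dlt hs hi
    exact ⟨h, (Nat.pow_le_pow_right two_pos (by omega)).trans h⟩
  · have h := two_pow_le_abs_sub_of_mem_Dlt hi hi' hne
    exact ⟨h, (hgap s hs).trans h⟩
  · have h := two_pow_max_le_abs_sub_of_mem_Dlt hs hs' hne hi hi'
    exact ⟨h, (hgap _ (le_max_of_le_left hs)).trans h⟩
  · rw [Set.disjoint_left]
    intro i hi hi'
    have h := two_pow_max_le_abs_sub_of_mem_Dlt hs hs' hne hi hi'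
    rw [sub_self, abs_zero] at h
    exact absurd h (not_le.2 (by positivity))
end

section
/- Fix integers d ≥ 1 and p ≥ 1 such that 2^{s+1+p} ≥ 2^{s+1} + 2d + 1 for every s ≥ 1. With I_j^{(s)} = [2^{j+1} − 2^{j−s+1}, 2^{j+1} − 2^{j−s}), L_j^{(s)} = { i ∈ I_j^{(s)} : dist(i, ℕ∖I_j^{(s)}) ≥ 2^{s+1+p} and 2^{s+1+p} divides i }, J = 5ℕ ∪ (5ℕ+2), D_s = ⋃_{j≥2s+p+2, j∈J} L_j^{(s)}, let (q_l)_{l≥1} be the increasing enumeration of J ∩ [p+4, ∞) and N_l = 2^{q_l+1}. Then for every s ≥ 1 and every l ≥ 1, dist(N_l, D_s) ≥ 2^s + d. -/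
open Filter Topology

/-- For `1 ≤ s ≤ j`, the only power of two that `Iset s j` can contain is `2 ^ j`. -/
theorem eq_of_two_pow_mem_Iset {s j n : ℕ} (hs : 1 ≤ s) (hsj : s ≤ j) (h : 2 ^ n ∈ Iset s j) :
    n = j := by
  obtain ⟨h₁, h₂⟩ := h
  have hpow : 2 ^ (j - s + 1) ≤ 2 ^ j := Nat.pow_le_pow_right two_pos (by omega)
  have hsucc : 2 ^ (j + 1) = 2 * 2 ^ j := pow_succ' 2 j
  have hle : 2 ^ j ≤ 2 ^ n := by omega
  have hlt : 2 ^ n < 2 ^ (j + 1) := by omega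
  have := (Nat.pow_le_pow_iff_right one_lt_two).1 hle
  have := (Nat.pow_lt_pow_iff_right one_lt_two).1 hlt
  omega

/-- If `(q_l)` is the increasing enumeration of `J ∩ [p+4, ∞)` and `N_l = 2^{q_l+1}`, then
`dist(N_l, D_s) ≥ 2^s + d` for every `s ≥ 1` and every `l`. -/
theorem stmt_15 (d p : ℕ) (hd : 1 ≤ d) (hp : 1 ≤ p)
    (hdp : ∀ s : ℕ, 1 ≤ s → 2 ^ (s + 1) + 2 * d + 1 ≤ 2 ^ (s + 1 + p))
    (q : ℕ → ℕ) (hq : StrictMono q)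
    (hqrange : ∀ j : ℕ, j ∈ Set.range q ↔ ((j % 5 = 0 ∨ j % 5 = 2) ∧ p + 4 ≤ j)) :
    ∀ s : ℕ, 1 ≤ s → ∀ l : ℕ, ∀ k ∈ Dset p s,
      (2 : ℤ) ^ s + (d : ℤ) ≤ |((2 ^ (q l + 1) : ℕ) : ℤ) - (k : ℤ)| := by
  rintro s hs l k ⟨j, hj, hjJ, -, hdist, -⟩
  obtain ⟨hqJ, -⟩ := (hqrange (q l)).1 ⟨l, rfl⟩
  have hnot : 2 ^ (q l + 1) ∉ Iset s j := fun h => by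
    have := eq_of_two_pow_mem_Iset hs (by omega) h
    omega
  have hfar := hdist _ hnot
  rw [abs_sub_comm] at hfar
  refine le_trans ?_ hfar
  have hbound : (2 : ℤ) ^ (s + 1) + 2 * d + 1 ≤ 2 ^ (s + 1 + p) := mod_cast hdp s hs
  have hpos : (0 : ℤ) < 2 ^ s := by positivity
  rw [pow_succ] at hbound
  linarith [Int.natCast_nonneg d]
end

section
/- Fix integers d ≥ 1 and p ≥ 1 such that 2^{s+1+p} ≥ 2^{s+1} + 2d + 1 for every s ≥ 1. With I_j^{(s)} = [2^{j+1} − 2^{j−s+1}, 2^{j+1} − 2^{j−s}), L_j^{(s)} = { i ∈ I_j^{(s)} : dist(i, ℕ∖I_j^{(s)}) ≥ 2^{s+1+p} and 2^{s+1+p} divides i }, J = 5ℕ ∪ (5ℕ+2), D_s = ⋃_{j≥2s+p+2, j∈J} L_j^{(s)}, let (q_l)_{l≥1} be the increasing enumeration of J ∩ [p+4, ∞) and N_l = 2^{q_l+1}. Then, for every s ≥ 1: the sets of indices {l : q_l ≡ 0 mod 5} and {l : q_l ≡ 2 mod 5} are both infinite, and (1/N_l)·#(D_s∩[1,N_l])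 converges to (36/31)·2^{−2s−p−2} as l → ∞ along l with q_l ≡ 0 mod 5, while (1/N_l)·#(D_s∩[1,N_l]) converges to (40/31)·2^{−2s−p−2} as l → ∞ along l with q_l ≡ 2 mod 5; in particular these two limits are distinct and both positive. -/
open Filter Topology

lemma Iset_eq_Ico (p s k : ℕ) :
    Iset s (2 * s + p + 2 + k) =
      Set.Ico (2 ^ (s + 1 + p) * (2 * 2 ^ (k + 1) * (2 ^ s - 1)))
        (2 ^ (s + 1 + p) * (2 * 2 ^ (k + 1) * (2 ^ s - 1) + 2 ^ (k + 1))) := by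
  obtain ⟨T, hT⟩ : ∃ T, 2 ^ s = T + 1 := ⟨2 ^ s - 1, by have := Nat.one_le_two_pow (n := s); omega⟩
  have h1 : 2 * s + p + 2 + k - s = (s + 1 + p) + (k + 1) := by omega
  have h2 : 2 * s + p + 2 + k + 1 = (s + 1 + p) + (k + 1) + s + 1 := by ring
  have e1 : 2 ^ (2 * s + p + 2 + k - s) = 2 ^ (s + 1 + p) * 2 ^ (k + 1) := by rw [h1, pow_add]
  have e2 : 2 ^ (2 * s + p + 2 + k - s + 1) = 2 * (2 ^ (s + 1 + p) * 2 ^ (k + 1)) := by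
    rw [pow_succ, e1, mul_comm]
  have e3 : 2 ^ (2 * s + p + 2 + k + 1) = 2 ^ (s + 1 + p) * 2 ^ (k + 1) * (T + 1) * 2 := by
    rw [h2, pow_succ, pow_add _ _ s, pow_add _ _ (k + 1), hT]
  unfold Iset
  rw [e1, e2, e3, hT, Nat.add_sub_cancel]
  congr 1
  · apply Nat.sub_eq_of_eq_add; ring
  · apply Nat.sub_eq_of_eq_add; ring

lemma Lset_eq_image {p s j A B : ℕ} (hA : 1 ≤ A)
    (h : Iset s j = Set.Ico (2 ^ (s + 1 + p) * A) (2 ^ (s + 1 + p) * B)) :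
    Lset p s j = (fun x => 2 ^ (s + 1 + p) * x) '' Set.Ioo A B := by
  have hP2 : 2 ≤ 2 ^ (s + 1 + p) := Nat.le_self_pow (by omega) 2
  have hcast : (2 : ℤ) ^ (s + 1 + p) = ((2 ^ (s + 1 + p) : ℕ) : ℤ) := by push_cast; rfl
  unfold Lset
  rw [h, hcast]
  generalize 2 ^ (s + 1 + p) = P at hP2
  have hPA : P ≤ P * A := Nat.le_mul_of_pos_right P hA
  ext i
  constructor
  · rintro ⟨⟨hi1, hi2⟩, hm, x, rfl⟩
    refine ⟨x, ⟨?_, lt_of_mul_lt_mul_left hi2 (Nat.zero_le P)⟩, rfl⟩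
    by_contra hx
    have hx' : P * x ≤ P * A := Nat.mul_le_mul_left P (not_lt.mp hx)
    have := hm (P * A - 1) (fun hmem => by have := hmem.1; omega)
    have h2 : ((P * x : ℕ) : ℤ) - ((P * A - 1 : ℕ) : ℤ) = 1 := by omega
    rw [h2, abs_one] at this
    omega
  · rintro ⟨x, ⟨hx1, hx2⟩, rfl⟩
    have h1 : P * A + P ≤ P * x := by
      rw [← Nat.mul_succ]; exact Nat.mul_le_mul_left P hx1
    have h2 : P * x + P ≤ P * B := by
      rw [← Nat.mul_succ]; exact Nat.mul_le_mul_left P hx2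
    refine ⟨⟨by simp only; omega, by simp only; omega⟩, fun m hm => ?_, Dvd.intro x rfl⟩
    simp only [Set.mem_Ico, not_and_or, not_le, not_lt] at hm ⊢
    rcases hm with hm | hm
    · exact le_trans (by omega) (le_abs_self _)
    · exact le_trans (by omega) (neg_le_abs _)

lemma Lset_eq (p k : ℕ) {s : ℕ} (hs : 1 ≤ s) :
    Lset p s (2 * s + p + 2 + k) = (fun x => 2 ^ (s + 1 + p) * x) ''
      Set.Ioo (2 * 2 ^ (k + 1) * (2 ^ s - 1)) (2 * 2 ^ (k + 1) * (2 ^ s - 1) + 2 ^ (k + 1)) := by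
  have : 2 ≤ 2 ^ s := Nat.le_self_pow (by omega) 2
  have h1 : 1 ≤ 2 ^ s - 1 := by omega
  exact Lset_eq_image (Nat.mul_pos (by positivity) h1) (Iset_eq_Ico p s k)

lemma ncard_Lset (p k : ℕ) {s : ℕ} (hs : 1 ≤ s) :
    (Lset p s (2 * s + p + 2 + k)).ncard = 2 ^ (k + 1) - 1 := by
  rw [Lset_eq p k hs, Set.ncard_image_of_injective _
    (mul_right_injective₀ (pow_ne_zero _ two_ne_zero)), ← Finset.coe_Ioo, Set.ncard_coe_finset, Nat.card_Ioo,
    Nat.add_sub_cancel_left]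

lemma Lset_subset_Ioo {p s j : ℕ} (hs : 1 ≤ s) (hj : 2 * s + p + 2 ≤ j) :
    Lset p s j ⊆ Set.Ioo (2 ^ j) (2 ^ (j + 1)) := by
  obtain ⟨k, rfl⟩ := Nat.exists_eq_add_of_le hj
  rw [Lset_eq p k hs]
  rintro _ ⟨x, ⟨hx1, hx2⟩, rfl⟩
  have h2 : 2 ≤ 2 ^ s := Nat.le_self_pow (by omega) 2
  obtain ⟨T, hT⟩ : ∃ T, 2 ^ s = T + 2 := ⟨2 ^ s - 2, by omega⟩
  have e : 2 ^ (2 * s + p + 2 + k) = 2 ^ (s + 1 + p) * (2 ^ (k + 1) * (T + 2)) := by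
    rw [← hT]; ring
  have hP : 0 < 2 ^ (s + 1 + p) := by positivity
  rw [hT, show T + 2 - 1 = T + 1 from rfl] at hx1 hx2
  rw [Set.mem_Ioo, pow_succ, e, mul_assoc]
  have hu : 0 < 2 ^ (k + 1) := by positivity
  exact ⟨Nat.mul_lt_mul_of_pos_left (by nlinarith) hP,
    Nat.mul_lt_mul_of_pos_left (by nlinarith) hP⟩

lemma Dset_inter_succ {p s n : ℕ} (hs : 1 ≤ s) (hn : 2 * s + p + 2 ≤ n) :
    Dset p s ∩ Set.Icc 1 (2 ^ (n + 1)) =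
      (Dset p s ∩ Set.Icc 1 (2 ^ n)) ∪ {i | (n % 5 = 0 ∨ n % 5 = 2) ∧ i ∈ Lset p s n} := by
  have h2n : 2 ^ n ≤ 2 ^ (n + 1) := Nat.pow_le_pow_right (by norm_num) (by omega)
  ext i
  constructor
  · rintro ⟨⟨j, hj, hjJ, hi⟩, hi1, hi2⟩
    have hb := Lset_subset_Ioo hs hj hi
    have hjn : j < n + 1 := (Nat.pow_lt_pow_iff_right (a := 2) (by norm_num)).mp
      (hb.1.trans_le hi2)
    rcases Nat.lt_succ_iff_lt_or_eq.mp hjn with hlt | rfl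
    · exact Or.inl ⟨⟨j, hj, hjJ, hi⟩, hi1,
        hb.2.le.trans (Nat.pow_le_pow_right (by norm_num) hlt)⟩
    · exact Or.inr ⟨hjJ, hi⟩
  · rintro (⟨hi, hi1, hi2⟩ | ⟨hJ, hi⟩)
    · exact ⟨hi, hi1, hi2.trans h2n⟩
    · have hb := Lset_subset_Ioo hs hn hi
      exact ⟨⟨n, hn, hJ, hi⟩, (Nat.zero_le _).trans_lt hb.1, hb.2.le⟩

lemma ncard_Dset_inter_succ_of_mem {p s k : ℕ} (hs : 1 ≤ s)
    (hJ : (2 * s + p + 2 + k) % 5 = 0 ∨ (2 * s + p + 2 + k) % 5 = 2) :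
    (Dset p s ∩ Set.Icc 1 (2 ^ (2 * s + p + 2 + k + 1))).ncard =
      (Dset p s ∩ Set.Icc 1 (2 ^ (2 * s + p + 2 + k))).ncard + (2 ^ (k + 1) - 1) := by
  rw [Dset_inter_succ hs (Nat.le_add_right _ _), ← ncard_Lset p k hs]
  simp only [hJ, true_and, Set.ofPred_mem_eq]
  refine Set.ncard_union_eq (Set.disjoint_left.mpr fun i hi hL => ?_)
    ((Set.finite_Icc _ _).inter_of_right _)
    ((Set.finite_Ioo _ _).subset (Lset_subset_Ioo hs (Nat.le_add_right _ _)))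
  exact absurd hi.2.2 (not_le.mpr (Lset_subset_Ioo hs (Nat.le_add_right _ _) hL).1)

lemma ncard_Dset_inter_succ_of_notMem {p s n : ℕ} (hs : 1 ≤ s) (hn : 2 * s + p + 2 ≤ n)
    (hJ : ¬(n % 5 = 0 ∨ n % 5 = 2)) :
    (Dset p s ∩ Set.Icc 1 (2 ^ (n + 1))).ncard = (Dset p s ∩ Set.Icc 1 (2 ^ n)).ncard := by
  rw [Dset_inter_succ hs hn]
  simp [hJ]

/-- The limit of `∑_{j ≤ n, j ∈ J} 2 ^ (j - n)` along `n` in a fixed residue class modulo `5`. -/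
noncomputable def geomWeight (n : ℕ) : ℝ :=
  if n % 5 = 0 then 36 / 31 else if n % 5 = 1 then 18 / 31 else if n % 5 = 2 then 40 / 31
    else if n % 5 = 3 then 20 / 31 else 10 / 31

lemma geomWeight_succ_of_mem {n : ℕ} (h : (n + 1) % 5 = 0 ∨ (n + 1) % 5 = 2) :
    geomWeight (n + 1) = geomWeight n / 2 + 1 := by
  unfold geomWeight
  rcases h with h | h
  · have h' : n % 5 = 4 := by omega
    norm_num [h, h']
  · have h' : n % 5 = 1 := by omega
    norm_num [h, h']

lemma geomWeight_succ_of_notMem {n : ℕ} (h : ¬((n + 1) % 5 = 0 ∨ (n + 1) % 5 = 2)) :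
    geomWeight (n + 1) = geomWeight n / 2 := by
  unfold geomWeight
  have h' : (n % 5 = 0 ∧ (n + 1) % 5 = 1) ∨ (n % 5 = 2 ∧ (n + 1) % 5 = 3) ∨
    (n % 5 = 3 ∧ (n + 1) % 5 = 4) := by omega
  rcases h' with ⟨h1, h2⟩ | ⟨h1, h2⟩ | ⟨h1, h2⟩ <;> norm_num [h1, h2]

lemma exists_abs_ncard_Dset_sub_le (p : ℕ) {s : ℕ} (hs : 1 ≤ s) :
    ∃ A : ℝ, ∀ k : ℕ,
      |((Dset p s ∩ Set.Icc 1 (2 ^ (2 * s + p + 2 + k + 1))).ncard : ℝ) -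
        geomWeight (2 * s + p + 2 + k) * 2 ^ (k + 1)| ≤ A + k := by
  obtain ⟨A, hA⟩ := Set.nonempty_Ici (a :=
    |((Dset p s ∩ Set.Icc 1 (2 ^ (2 * s + p + 2 + 0 + 1))).ncard : ℝ) -
      geomWeight (2 * s + p + 2 + 0) * 2 ^ (0 + 1)|)
  refine ⟨A, fun k => ?_⟩
  induction k with
  | zero => rwa [Nat.cast_zero, add_zero A]
  | succ k ih =>
    by_cases hJ : (2 * s + p + 2 + k + 1) % 5 = 0 ∨ (2 * s + p + 2 + k + 1) % 5 = 2
    · rw [ncard_Dset_inter_succ_of_mem hs hJ, ← add_assoc (2 * s + p + 2) k 1,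
        geomWeight_succ_of_mem hJ, Nat.cast_add, Nat.cast_sub Nat.one_le_two_pow]
      push_cast
      rw [abs_le] at ih ⊢
      rw [pow_succ _ (k + 1)]
      constructor <;> linarith [ih.1, ih.2]
    · rw [← add_assoc (2 * s + p + 2) k 1,
        ncard_Dset_inter_succ_of_notMem hs (by omega) hJ, geomWeight_succ_of_notMem hJ]
      push_cast
      rw [abs_le] at ih ⊢
      rw [pow_succ _ (k + 1)]
      constructor <;> linarith [ih.1, ih.2]

lemma tendsto_partialDensity_Dset_sub (p : ℕ) {s : ℕ} (hs : 1 ≤ s) :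
    Tendsto (fun n => partialDensity (Dset p s) (2 ^ (n + 1)) -
      geomWeight n * ((2 : ℝ) ^ (2 * s + p + 2))⁻¹) atTop (𝓝 0) := by
  obtain ⟨A, hA⟩ := exists_abs_ncard_Dset_sub_le p hs
  rw [← tendsto_add_atTop_iff_nat (2 * s + p + 2)]
  have hlim : Tendsto (fun k : ℕ => A * (1 / 2 : ℝ) ^ k + k * (1 / 2 : ℝ) ^ k) atTop (𝓝 0) := by
    have h1 := (tendsto_pow_atTop_nhds_zero_of_lt_one (r := (1 / 2 : ℝ)) (by norm_num)
      (by norm_num)).const_mul A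
    have h2 := tendsto_self_mul_const_pow_of_lt_one (r := (1 / 2 : ℝ)) (by norm_num) (by norm_num)
    simpa using h1.add h2
  refine squeeze_zero_norm (fun k => ?_) hlim
  rw [add_comm k, Real.norm_eq_abs]
  have hpos : (0 : ℝ) < 2 ^ (2 * s + p + 2 + k + 1) := by positivity
  have hsplit : (2 : ℝ) ^ (2 * s + p + 2 + k + 1) = 2 ^ (2 * s + p + 2) * 2 ^ (k + 1) := by
    rw [add_assoc _ k 1, pow_add]
  have hA0 : 0 ≤ A + k := (abs_nonneg _).trans (hA k)
  have heq : partialDensity (Dset p s) (2 ^ (2 * s + p + 2 + k + 1)) -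
      geomWeight (2 * s + p + 2 + k) * ((2 : ℝ) ^ (2 * s + p + 2))⁻¹ =
      (((Dset p s ∩ Set.Icc 1 (2 ^ (2 * s + p + 2 + k + 1))).ncard : ℝ) -
        geomWeight (2 * s + p + 2 + k) * 2 ^ (k + 1)) / 2 ^ (2 * s + p + 2 + k + 1) := by
    unfold partialDensity
    push_cast
    rw [hsplit]
    field_simp
  rw [heq, abs_div, abs_of_pos hpos]
  calc _ ≤ (A + k) / 2 ^ (2 * s + p + 2 + k + 1) := by gcongr; exact hA k
    _ ≤ (A + k) / 2 ^ k := by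
      gcongr
      · norm_num
      · omega
    _ = _ := by rw [one_div, inv_pow]; ring

lemma infinite_setOf_mod_five {q : ℕ → ℕ} {r m : ℕ} (hr : r < 5)
    (hq : ∀ j, j % 5 = r → m ≤ j → j ∈ Set.range q) : {l : ℕ | q l % 5 = r}.Infinite := by
  have hinf : {j : ℕ | j % 5 = r ∧ m ≤ j}.Infinite :=
    Set.infinite_of_forall_exists_gt fun a =>
      ⟨5 * (a + m + 1) + r, ⟨by omega, by omega⟩, by omega⟩
  refine Set.Infinite.of_image q (hinf.mono ?_)
  rintro j ⟨hj, hmj⟩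
  obtain ⟨l, rfl⟩ := hq j hj hmj
  exact ⟨l, hj, rfl⟩

/-- If `(q_l)` is the increasing enumeration of `J ∩ [p+4, ∞)` and `N_l = 2^{q_l+1}`, then for
every `s ≥ 1` the index sets `{l : q_l ≡ 0 [5]}` and `{l : q_l ≡ 2 [5]}` are infinite, and
`(1/N_l)·#(D_s∩[1,N_l])` converges to `(36/31)·2^{−2s−p−2}` along `q_l ≡ 0 [5]` and to
`(40/31)·2^{−2s−p−2}` along `q_l ≡ 2 [5]`; these two limits are positive and distinct. -/
theorem stmt_16 (d p : ℕ) (hd : 1 ≤ d) (hp : 1 ≤ p)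
    (hdp : ∀ s : ℕ, 1 ≤ s → 2 ^ (s + 1) + 2 * d + 1 ≤ 2 ^ (s + 1 + p))
    (q : ℕ → ℕ) (hq : StrictMono q)
    (hqrange : ∀ j : ℕ, j ∈ Set.range q ↔ ((j % 5 = 0 ∨ j % 5 = 2) ∧ p + 4 ≤ j)) :
    {l : ℕ | q l % 5 = 0}.Infinite ∧ {l : ℕ | q l % 5 = 2}.Infinite ∧
    ∀ s : ℕ, 1 ≤ s →
      (∀ δ : ℝ, 0 < δ → ∃ L : ℕ, ∀ l : ℕ, L ≤ l → q l % 5 = 0 →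
        |partialDensity (Dset p s) (2 ^ (q l + 1)) -
          (36 / 31) * ((2 : ℝ) ^ (2 * s + p + 2))⁻¹| < δ) ∧
      (∀ δ : ℝ, 0 < δ → ∃ L : ℕ, ∀ l : ℕ, L ≤ l → q l % 5 = 2 →
        |partialDensity (Dset p s) (2 ^ (q l + 1)) -
          (40 / 31) * ((2 : ℝ) ^ (2 * s + p + 2))⁻¹| < δ) ∧
      0 < (36 / 31) * ((2 : ℝ) ^ (2 * s + p + 2))⁻¹ ∧
      (36 / 31) * ((2 : ℝ) ^ (2 * s + p + 2))⁻¹ <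
        (40 / 31) * ((2 : ℝ) ^ (2 * s + p + 2))⁻¹ := by
  refine ⟨infinite_setOf_mod_five (by norm_num) fun j hj h => (hqrange j).mpr ⟨Or.inl hj, h⟩,
    infinite_setOf_mod_five (by norm_num) fun j hj h => (hqrange j).mpr ⟨Or.inr hj, h⟩,
    fun s hs => ?_⟩
  have hlim := (tendsto_partialDensity_Dset_sub p hs).comp hq.tendsto_atTop
  rw [Metric.tendsto_atTop] at hlim
  simp only [Function.comp_apply, Real.dist_eq, sub_zero] at hlim
  refine ⟨fun δ hδ => ?_, fun δ hδ => ?_, by positivity, by gcongr; norm_num⟩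
  · obtain ⟨L, hL⟩ := hlim δ hδ
    refine ⟨L, fun l hl hl0 => ?_⟩
    simpa [geomWeight, hl0] using hL l hl
  · obtain ⟨L, hL⟩ := hlim δ hδ
    refine ⟨L, fun l hl hl2 => ?_⟩
    simpa [geomWeight, hl2] using hL l hl
end

section
/- For every integer d ≥ 1 there exist a sequence (D_s)_{s≥1} of subsets of ℕ and a strictly increasing sequence (N_l)_{l≥1} of positive integers with the following properties: (i) min D_s ≥ 2^{s+1} for every s ≥ 1; (ii') for every s ≥ 1 and all distinct i, i' ∈ D_s, |i−i'| ≥ 2^{s+1}+2d+1; (iii') for all s ≠ s', all i ∈ D_s and i' ∈ D_{s'}, |i−i'| ≥ 2^{max(s,s')+1}+2d+1; (iv) each D_s has positive lower density; (v-a) dist(N_l, D_s) ≥ 2^s + d for every s ≥ 1 and l ≥ 1; (v-b) Σ_{s≥1} 2^s α_s < ∞, where α_s = sup_{l≥1} (1/N_l)·#(D_s∩[1,N_l]); (v-c) there exist two subsequences (N_l^{(1)})_{l≥1} and (N_l^{(2)})_{l≥1} of (N_l)_{l≥1} and, for every s ≥ 1, constants 0 < β_s < γ_s such that (1/N_l^{(1)})·#(D_s∩[1,N_l^{(1)}])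 → β_s and (1/N_l^{(2)})·#(D_s∩[1,N_l^{(2)}]) → γ_s as l → ∞. -/
open Filter Topology

/-- Positions of the form `g * k` with `k` in one of the blocks
`[2 ^ (m + 2i) (2 ^ s + 1), 2 ^ (m + 2i) (2 ^ s + 2))`, where `g = 2 ^ (s + m)`. In terms of the
position itself, the `i`-th block is `[4 ^ j + 4 ^ j / 2 ^ s, 4 ^ j + 2 * 4 ^ j / 2 ^ s)` with
`j = s + m + i`. -/
def dyadicBlocks (m s : ℕ) : Set ℕ :=
  {n | ∃ i k, n = 2 ^ (s + m) * k ∧ 2 ^ (m + 2 * i) * (2 ^ s + 1) ≤ k ∧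
    k < 2 ^ (m + 2 * i) * (2 ^ s + 2)}

theorem dvd_of_mem_dyadicBlocks {m s n : ℕ} (h : n ∈ dyadicBlocks m s) : 2 ^ (s + m) ∣ n := by
  obtain ⟨i, k, rfl, -, -⟩ := h
  exact dvd_mul_right _ _

theorem exists_zone_of_mem_dyadicBlocks {m s n : ℕ} (h : n ∈ dyadicBlocks m s) :
    ∃ j, s + m ≤ j ∧ 2 ^ (2 * j) + 2 ^ (2 * j - s) ≤ n ∧
      n + 2 ^ (s + m) ≤ 2 ^ (2 * j) + 2 ^ (2 * j - s + 1) := by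
  obtain ⟨i, k, rfl, h₁, h₂⟩ := h
  have e₁ : 2 ^ (2 * (s + m + i)) = 2 ^ (s + m) * (2 ^ (m + 2 * i) * 2 ^ s) := by
    rw [← pow_add, ← pow_add]; congr 1; omega
  have e₂ : 2 ^ (2 * (s + m + i) - s) = 2 ^ (s + m) * 2 ^ (m + 2 * i) := by
    rw [← pow_add]; congr 1; omega
  refine ⟨s + m + i, by omega, ?_, ?_⟩
  · rw [e₁, e₂, ← mul_add]
    exact Nat.mul_le_mul_left _ (by linarith)
  · rw [pow_succ, e₁, e₂, mul_assoc, ← mul_add, ← Nat.mul_succ]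
    exact Nat.mul_le_mul_left _ (by linarith [Nat.succ_le_of_lt h₂])

theorem dyadicBlocks_self_separated {m s n n' : ℕ} (h : n ∈ dyadicBlocks m s)
    (h' : n' ∈ dyadicBlocks m s) (hne : n ≠ n') :
    (2 : ℤ) ^ (s + m) ≤ |(n : ℤ) - n'| := by
  have hd : (2 : ℤ) ^ (s + m) ∣ (n : ℤ) - n' := by
    refine dvd_sub ?_ ?_
    · exact_mod_cast dvd_of_mem_dyadicBlocks h
    · exact_mod_cast dvd_of_mem_dyadicBlocks h'
  refine Int.le_of_dvd (abs_pos.2 ?_) ((dvd_abs _ _).2 hd)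
  rw [sub_ne_zero]
  exact_mod_cast hne

theorem dyadicBlocks_separated {m s t n n' : ℕ} (hs : 1 ≤ s) (hst : s < t)
    (h : n ∈ dyadicBlocks m s) (h' : n' ∈ dyadicBlocks m t) :
    (2 : ℤ) ^ (t + m) ≤ |(n : ℤ) - n'| := by
  obtain ⟨j, hj, h₁, h₂⟩ := exists_zone_of_mem_dyadicBlocks h
  obtain ⟨j', hj', h₁', h₂'⟩ := exists_zone_of_mem_dyadicBlocks h'
  have hpow : ∀ {a b : ℕ}, a ≤ b → 2 ^ a ≤ 2 ^ b := fun hab => Nat.pow_le_pow_right two_pos hab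
  have key : n' + 2 ^ (t + m) ≤ n ∨ n + 2 ^ (t + m) ≤ n' := by
    rcases lt_trichotomy j j' with hlt | rfl | hlt
    · right
      have a₁ : 2 ^ (2 * j - s + 1) ≤ 2 ^ (2 * j) := hpow (by omega)
      have a₂ : 2 ^ (2 * j + 1) ≤ 2 ^ (2 * j') := hpow (by omega)
      have a₃ : 2 ^ (t + m) ≤ 2 ^ (2 * j' - t) := hpow (by omega)
      have a₅ := Nat.two_pow_pos (s + m)
      have a₄ := Nat.pow_succ (n := 2) (m := 2 * j)
      omega
    · left
      have a₁ : 2 ^ (2 * j - t + 1) ≤ 2 ^ (2 * j - s) := hpow (by omega)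
      omega
    · left
      have a₁ : 2 ^ (2 * j' - t + 1) ≤ 2 ^ (2 * j') := hpow (by omega)
      have a₂ : 2 ^ (2 * j' + 1) ≤ 2 ^ (2 * j) := hpow (by omega)
      have a₅ := Nat.two_pow_pos (2 * j - s)
      have a₄ := Nat.pow_succ (n := 2) (m := 2 * j')
      omega
  rw [le_abs]
  zify at key
  rcases key with h | h
  · left; linarith
  · right; linarith

theorem dyadicBlocks_two_pow_separated {m s n : ℕ} (hs : 1 ≤ s) (l : ℕ)
    (h : n ∈ dyadicBlocks m s) : (2 : ℤ) ^ (s + m) ≤ |((2 ^ l : ℕ) : ℤ) - n| := by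
  obtain ⟨j, hj, h₁, h₂⟩ := exists_zone_of_mem_dyadicBlocks h
  have hpow : ∀ {a b : ℕ}, a ≤ b → 2 ^ a ≤ 2 ^ b := fun hab => Nat.pow_le_pow_right two_pos hab
  have key : n + 2 ^ (s + m) ≤ 2 ^ l ∨ 2 ^ l + 2 ^ (s + m) ≤ n := by
    rcases le_or_gt l (2 * j) with hl | hl
    · right
      have a₁ : 2 ^ l ≤ 2 ^ (2 * j) := hpow hl
      have a₂ : 2 ^ (s + m) ≤ 2 ^ (2 * j - s) := hpow (by omega)
      omega
    · left
      have a₁ : 2 ^ (2 * j - s + 1) ≤ 2 ^ (2 * j) := hpow (by omega)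
      have a₂ : 2 ^ (2 * j + 1) ≤ 2 ^ l := hpow hl
      have a₄ := Nat.pow_succ (n := 2) (m := 2 * j)
      omega
  rw [le_abs]
  zify at key
  push_cast
  rcases key with h | h
  · left; linarith
  · right; linarith

theorem dyadicBlocks_inter_Icc {m s : ℕ} (hs : 1 ≤ s) (l : ℕ) :
    dyadicBlocks m s ∩ Set.Icc 1 (2 ^ l) =
      (((Finset.range ((l + 1) / 2 - (s + m))).biUnion fun i =>
        Finset.Ico (2 ^ (m + 2 * i) * (2 ^ s + 1)) (2 ^ (m + 2 * i) * (2 ^ s + 2))).image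
          (2 ^ (s + m) * ·) : Finset ℕ) := by
  ext n
  simp only [dyadicBlocks, Set.mem_inter_iff, Set.mem_ofPred_eq, Set.mem_Icc, Finset.coe_image,
    Finset.coe_biUnion, Set.mem_image, Set.mem_iUnion, Finset.coe_Ico, Set.mem_Ico,
    Finset.mem_coe, Finset.mem_range, exists_prop]
  constructor
  · rintro ⟨⟨i, k, rfl, h₁, h₂⟩, -, hn⟩
    refine ⟨k, ⟨i, ?_, h₁, h₂⟩, rfl⟩
    by_contra hi
    have hl : 2 ^ l ≤ 2 ^ (s + m) * (2 ^ (m + 2 * i) * 2 ^ s) := by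
      rw [← pow_add, ← pow_add]
      exact Nat.pow_le_pow_right two_pos (by omega)
    have hk : 2 ^ (m + 2 * i) * 2 ^ s < k := by
      have := Nat.two_pow_pos (m + 2 * i)
      linarith
    have := Nat.mul_lt_mul_of_pos_left hk (Nat.two_pow_pos (s + m))
    omega
  · rintro ⟨k, ⟨i, hi, h₁, h₂⟩, rfl⟩
    refine ⟨⟨i, k, rfl, h₁, h₂⟩, ?_, ?_⟩
    · have : 0 < k := lt_of_lt_of_le (by positivity) h₁
      exact Nat.mul_pos (Nat.two_pow_pos _) this
    · have h2s : 2 ^ s + 2 ≤ 2 ^ (s + 1) := by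
        have : 2 ^ 1 ≤ 2 ^ s := Nat.pow_le_pow_right two_pos hs
        omega
      calc 2 ^ (s + m) * k ≤ 2 ^ (s + m) * (2 ^ (m + 2 * i) * 2 ^ (s + 1)) :=
            Nat.mul_le_mul_left _ (h₂.le.trans (Nat.mul_le_mul_left _ h2s))
        _ ≤ 2 ^ l := by
            rw [← pow_add, ← pow_add]
            exact Nat.pow_le_pow_right two_pos (by omega)

theorem three_mul_ncard_dyadicBlocks {m s : ℕ} (hs : 1 ≤ s) (l : ℕ) :
    3 * (dyadicBlocks m s ∩ Set.Icc 1 (2 ^ l)).ncard + 2 ^ m =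
      2 ^ m * 4 ^ ((l + 1) / 2 - (s + m)) := by
  rw [dyadicBlocks_inter_Icc hs, Set.ncard_coe_finset,
    Finset.card_image_of_injective _ (mul_right_injective₀ (Nat.two_pow_pos _).ne'),
    Finset.card_biUnion]
  · have hcard : ∀ i, (Finset.Ico (2 ^ (m + 2 * i) * (2 ^ s + 1))
        (2 ^ (m + 2 * i) * (2 ^ s + 2))).card = 2 ^ m * 4 ^ i := by
      intro i
      rw [Nat.card_Ico, ← Nat.mul_sub, show 2 ^ s + 2 - (2 ^ s + 1) = 1 by omega, pow_add,
        pow_mul]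
      norm_num
    simp only [hcard]
    generalize (l + 1) / 2 - (s + m) = I
    induction I with
    | zero => simp
    | succ I ih => rw [Finset.sum_range_succ, pow_succ]; linarith
  · have hlt : ∀ i j : ℕ, i < j →
        2 ^ (m + 2 * i) * (2 ^ s + 2) ≤ 2 ^ (m + 2 * j) * (2 ^ s + 1) := by
      intro i j hij
      have h4 : 2 ^ (m + 2 * i) * 2 ^ 2 ≤ 2 ^ (m + 2 * j) := by
        rw [← pow_add]
        exact Nat.pow_le_pow_right two_pos (by omega)
      calc 2 ^ (m + 2 * i) * (2 ^ s + 2) ≤ 2 ^ (m + 2 * i) * (2 ^ 2 * (2 ^ s + 1)) :=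
            Nat.mul_le_mul_left _ (by linarith [Nat.two_pow_pos s])
        _ ≤ _ := by rw [← mul_assoc]; exact Nat.mul_le_mul_right _ h4
    intro i _ j _ hij
    rw [Function.onFun, Finset.disjoint_left]
    intro k hk hk'
    rw [Finset.mem_Ico] at hk hk'
    rcases lt_or_gt_of_ne hij with h | h
    · have := hlt i j h; omega
    · have := hlt j i h; omega

theorem partialDensity_dyadicBlocks {m s : ℕ} (hs : 1 ≤ s) (l : ℕ) :
    partialDensity (dyadicBlocks m s) (2 ^ l) =
      2 ^ m * (4 ^ ((l + 1) / 2 - (s + m)) - 1) / (3 * 2 ^ l) := by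
  have h : (3 : ℝ) * (dyadicBlocks m s ∩ Set.Icc 1 (2 ^ l)).ncard + 2 ^ m =
      2 ^ m * 4 ^ ((l + 1) / 2 - (s + m)) := by
    exact_mod_cast three_mul_ncard_dyadicBlocks hs l
  unfold partialDensity
  push_cast
  rw [div_eq_div_iff (by positivity) (by positivity)]
  linear_combination (2 ^ l : ℝ) * h

theorem partialDensity_dyadicBlocks_le {m s : ℕ} (hs : 1 ≤ s) (l : ℕ) :
    partialDensity (dyadicBlocks m s) (2 ^ l) ≤ 2 * (1 / 4) ^ s := by
  rw [partialDensity_dyadicBlocks hs, div_le_iff₀ (by positivity)]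
  rcases le_or_gt ((l + 1) / 2) (s + m) with h | h
  · rw [Nat.sub_eq_zero_of_le h]
    simp only [pow_zero, sub_self, mul_zero]
    positivity
  · obtain ⟨I, hI⟩ := Nat.exists_eq_add_of_lt h
    rw [show (l + 1) / 2 - (s + m) = I + 1 by omega]
    have hl : (2 : ℝ) ^ (2 * (s + m + I) + 1) ≤ 2 ^ l :=
      pow_le_pow_right₀ one_le_two (by omega)
    have e : (2 : ℝ) ^ (2 * (s + m + I) + 1) = 2 * (4 ^ s * 4 ^ m * 4 ^ I) := by
      rw [pow_succ, pow_mul, pow_add, pow_add]; norm_num; ring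
    have h4 : (1 / 4 : ℝ) ^ s * 4 ^ s = 1 := by rw [← mul_pow]; norm_num
    have hm : (2 : ℝ) ^ m ≤ 4 ^ m := pow_le_pow_left₀ two_pos.le (by norm_num) m
    calc (2 : ℝ) ^ m * (4 ^ (I + 1) - 1) ≤ 4 ^ m * 4 ^ (I + 1) := by
          exact mul_le_mul hm (sub_le_self _ zero_le_one)
            (sub_nonneg.2 (one_le_pow₀ (by norm_num))) (by positivity)
      _ ≤ 12 * ((1 / 4 : ℝ) ^ s * 4 ^ s) * (4 ^ m * 4 ^ I) := by
          rw [h4, pow_succ]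
          have : (0 : ℝ) < 4 ^ m * 4 ^ I := by positivity
          linarith
      _ = 2 * (1 / 4 : ℝ) ^ s * (3 * 2 ^ (2 * (s + m + I) + 1)) := by rw [e]; ring
      _ ≤ _ := by gcongr

/-- The limit of the partial densities of `dyadicBlocks m s` along the powers of four. -/
noncomputable def dyadicBlocksDensity (m s : ℕ) : ℝ := 2 ^ m / (3 * 4 ^ (s + m))

theorem dyadicBlocksDensity_pos (m s : ℕ) : 0 < dyadicBlocksDensity m s := by
  unfold dyadicBlocksDensity
  positivity

theorem tendsto_const_sub_pow_mul (c b : ℝ) :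
    Tendsto (fun l : ℕ => c - b * (1 / 4 : ℝ) ^ l) atTop (𝓝 c) := by
  have h := tendsto_pow_atTop_nhds_zero_of_lt_one (r := (1 / 4 : ℝ)) (by norm_num) (by norm_num)
  simpa using (h.const_mul b).const_sub c

theorem tendsto_partialDensity_even {m s : ℕ} (hs : 1 ≤ s) :
    Tendsto (fun l : ℕ => partialDensity (dyadicBlocks m s) (2 ^ (2 * l))) atTop
      (𝓝 (dyadicBlocksDensity m s)) := by
  refine (tendsto_const_sub_pow_mul _ (2 ^ m / 3)).congr' ?_
  filter_upwards [eventually_ge_atTop (s + m)] with l hl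
  obtain ⟨I, rfl⟩ := Nat.exists_eq_add_of_le hl
  rw [partialDensity_dyadicBlocks hs, show (2 * (s + m + I) + 1) / 2 - (s + m) = I by omega,
    pow_mul, dyadicBlocksDensity, pow_add _ (s + m) I, pow_add _ (s + m) I, one_div, inv_pow,
    inv_pow]
  norm_num
  field_simp

theorem tendsto_partialDensity_odd {m s : ℕ} (hs : 1 ≤ s) :
    Tendsto (fun l : ℕ => partialDensity (dyadicBlocks m s) (2 ^ (2 * l + 1))) atTop
      (𝓝 (2 * dyadicBlocksDensity m s)) := by
  refine (tendsto_const_sub_pow_mul _ (2 ^ m / 6)).congr' ?_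
  filter_upwards [eventually_ge_atTop (s + m)] with l hl
  obtain ⟨I, rfl⟩ := Nat.exists_eq_add_of_le hl
  rw [partialDensity_dyadicBlocks hs,
    show (2 * (s + m + I) + 1 + 1) / 2 - (s + m) = I + 1 by omega, pow_succ, pow_succ,
    pow_mul, dyadicBlocksDensity, pow_add _ (s + m) I, pow_add _ (s + m) I, one_div, inv_pow,
    inv_pow]
  norm_num
  field_simp
  ring

theorem partialDensity_four_pow_log_le (A : Set ℕ) {n : ℕ} (hn : n ≠ 0) :
    partialDensity A (2 ^ (2 * Nat.log 4 n)) / 4 ≤ partialDensity A n := by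
  have h₁ : 2 ^ (2 * Nat.log 4 n) ≤ n := by
    rw [pow_mul]; exact Nat.pow_log_le_self 4 hn
  have h₂ : n ≤ 2 ^ (2 * Nat.log 4 n) * 4 := by
    rw [pow_mul]; exact (Nat.lt_pow_succ_log_self (b := 4) (by norm_num) n).le
  have hc : (A ∩ Set.Icc 1 (2 ^ (2 * Nat.log 4 n))).ncard ≤ (A ∩ Set.Icc 1 n).ncard :=
    Set.ncard_le_ncard (Set.inter_subset_inter_right A (Set.Icc_subset_Icc_right h₁))
      ((Set.finite_Icc 1 n).inter_of_right A)
  unfold partialDensity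
  rw [div_div]
  have hn' : (0 : ℝ) < n := by exact_mod_cast Nat.pos_of_ne_zero hn
  refine div_le_div₀ (Nat.cast_nonneg _) (by exact_mod_cast hc) hn' (by exact_mod_cast h₂)

theorem lowerDensity_pos_of_tendsto {A : Set ℕ} {β : ℝ} (hβ : 0 < β)
    (h : Tendsto (fun l : ℕ => partialDensity A (2 ^ (2 * l))) atTop (𝓝 β)) :
    0 < lowerDensity A := by
  have hlog : Tendsto (Nat.log 4) atTop atTop := by
    refine tendsto_atTop.2 fun b => ?_
    filter_upwards [eventually_ge_atTop (4 ^ b)] with n hn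
    exact Nat.le_log_of_pow_le (by norm_num) hn
  have hev := (h.comp hlog).eventually (eventually_gt_nhds (half_lt_self hβ))
  refine lt_of_lt_of_le (show 0 < β / 8 by positivity) ?_
  refine le_liminf_of_le ?_ ?_
  · exact IsBoundedUnder.isCoboundedUnder_ge
      ⟨1, eventually_map.2 (Eventually.of_forall (partialDensity_le_one A))⟩
  · filter_upwards [hev, eventually_ne_atTop 0] with n hn hn0
    have := partialDensity_four_pow_log_le A hn0
    simp only [Function.comp_apply] at hn
    linarith

theorem two_pow_succ_add_le (d s : ℕ) :
    (2 : ℤ) ^ (s + 1) + 2 * d + 1 ≤ 2 ^ (s + (d + 2)) := by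
  have hd : (d : ℤ) + 1 ≤ 2 ^ d := by exact_mod_cast Nat.lt_two_pow_self (n := d)
  have hs : (1 : ℤ) ≤ 2 ^ s := one_le_pow₀ (by norm_num)
  have e : (2 : ℤ) ^ (s + (d + 2)) = 4 * (2 ^ s * 2 ^ d) := by ring
  have h := mul_le_mul_of_nonneg_left hd (by positivity : (0 : ℤ) ≤ 2 ^ s)
  rw [e, pow_succ]
  nlinarith

/-- For every `d ≥ 1` there exist sets `D_s ⊆ ℕ` (`s ≥ 1`) and a strictly increasing sequence
`(N_l)_{l≥1}` of positive integers satisfying conditions (i), (ii'), (iii'), (iv), (v-a), (v-b),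
(v-c) of the construction. -/
theorem stmt_17 (d : ℕ) (hd : 1 ≤ d) :
    ∃ (D : ℕ → Set ℕ) (N : ℕ → ℕ), StrictMono N ∧ (∀ l : ℕ, 0 < N l) ∧
      -- (i)
      (∀ s : ℕ, 1 ≤ s → ∀ k ∈ D s, 2 ^ (s + 1) ≤ k) ∧
      -- (ii')
      (∀ s : ℕ, 1 ≤ s → ∀ i ∈ D s, ∀ i' ∈ D s, i ≠ i' →
        (2 : ℤ) ^ (s + 1) + 2 * d + 1 ≤ |(i : ℤ) - (i' : ℤ)|) ∧
      -- (iii')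
      (∀ s s' : ℕ, 1 ≤ s → 1 ≤ s' → s ≠ s' → ∀ i ∈ D s, ∀ i' ∈ D s',
        (2 : ℤ) ^ (max s s' + 1) + 2 * d + 1 ≤ |(i : ℤ) - (i' : ℤ)|) ∧
      -- (iv)
      (∀ s : ℕ, 1 ≤ s → 0 < lowerDensity (D s)) ∧
      -- (v-a)
      (∀ s : ℕ, 1 ≤ s → ∀ l : ℕ, ∀ k ∈ D s,
        (2 : ℤ) ^ s + (d : ℤ) ≤ |(N l : ℤ) - (k : ℤ)|) ∧
      -- (v-b)
      Summable (fun s : ℕ => (2 : ℝ) ^ s * ⨆ l : ℕ, partialDensity (D s) (N l)) ∧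
      -- (v-c)
      ∃ k₁ k₂ : ℕ → ℕ, StrictMono k₁ ∧ StrictMono k₂ ∧
        ∃ βs γs : ℕ → ℝ, ∀ s : ℕ, 1 ≤ s → 0 < βs s ∧ βs s < γs s ∧
          Tendsto (fun l : ℕ => partialDensity (D s) (N (k₁ l))) atTop (𝓝 (βs s)) ∧
          Tendsto (fun l : ℕ => partialDensity (D s) (N (k₂ l))) atTop (𝓝 (γs s)) := by
  refine ⟨dyadicBlocks (d + 2), fun l => 2 ^ l,
    fun a b hab => Nat.pow_lt_pow_right (by norm_num) hab,
    fun l => Nat.two_pow_pos l, ?_, ?_, ?_, ?_, ?_, ?_, fun l => 2 * l, fun l => 2 * l + 1,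
    fun a b hab => by dsimp only; omega, fun a b hab => by dsimp only; omega,
    dyadicBlocksDensity (d + 2), fun s => 2 * dyadicBlocksDensity (d + 2) s, fun s hs =>
      ⟨dyadicBlocksDensity_pos _ s, by linarith [dyadicBlocksDensity_pos (d + 2) s],
        tendsto_partialDensity_even hs, tendsto_partialDensity_odd hs⟩⟩
  · intro s hs k hk
    obtain ⟨j, hj, h, -⟩ := exists_zone_of_mem_dyadicBlocks hk
    have : 2 ^ (s + 1) ≤ 2 ^ (2 * j) := Nat.pow_le_pow_right two_pos (by omega)
    exact this.trans ((Nat.le_add_right _ _).trans h)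
  · intro s hs i hi i' hi' hne
    exact (two_pow_succ_add_le d s).trans (dyadicBlocks_self_separated hi hi' hne)
  · intro s s' hs hs' hne i hi i' hi'
    refine (two_pow_succ_add_le d (max s s')).trans ?_
    rcases lt_or_gt_of_ne hne with h | h
    · rw [max_eq_right h.le]
      exact dyadicBlocks_separated hs h hi hi'
    · rw [max_eq_left h.le, abs_sub_comm]
      exact dyadicBlocks_separated hs' h hi' hi
  · intro s hs
    exact lowerDensity_pos_of_tendsto (dyadicBlocksDensity_pos _ s) (tendsto_partialDensity_even hs)
  · intro s hs l k hk
    refine le_trans ?_ (dyadicBlocks_two_pow_separated hs l hk)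
    refine le_trans ?_ (two_pow_succ_add_le d s)
    have : (0 : ℤ) < 2 ^ s := by positivity
    rw [pow_succ]
    linarith
  · rw [← summable_nat_add_iff 1]
    refine Summable.of_nonneg_of_le (fun s => ?_) (fun s => ?_) summable_geometric_two
    · exact mul_nonneg (by positivity) (Real.iSup_nonneg fun l => partialDensity_nonneg _ _)
    · calc (2 : ℝ) ^ (s + 1) * ⨆ l : ℕ, partialDensity (dyadicBlocks (d + 2) (s + 1)) (2 ^ l)
          ≤ 2 ^ (s + 1) * (2 * (1 / 4) ^ (s + 1)) := by
            gcongr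
            exact ciSup_le fun l => partialDensity_dyadicBlocks_le (by omega) l
        _ = 2 * (2 * (1 / 4)) ^ (s + 1) := by rw [mul_pow]; ring
        _ = (1 / 2) ^ s := by norm_num [pow_succ]; ring
end
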